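/- arXiv:1202.0154 — 5 statements merged into one kernel-verified Lean document; each statement's English description precedes it below -/
import Mathlib

section
/- Let α, β > −1 and let x_0 < ⋯ < x_n be the n+1 roots of the Jacobi polynomial P_{n+1}^{(α,β)}, which lie in (−1,1). Let λ_j := 1/∏_{k≠j}(x_j − x_k) be the barycentric weights and w_j := ∫_{−1}^1 (1−x)^α (1+x)^β ∏_{k≠j}((x − x_k)/(x_j − x_k)) dx the Gauss–Jacobi quadrature weights. Then for every j = 0,…,n: λ_j = (−1)^{n+j} · [ Γ(2n+α+β+3) / ( 2^{n+1+(α+β+1)/2} √( (n+1)! · Γ(n+α+β+2) Γ(n+α+2) Γ(n+β+2) ) ) ] · √( (1 − x_j²) w_j ). -/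
open MeasureTheory Finset Real

/-- The Jacobi polynomial `P_n^{(α,β)}` defined by the Rodrigues formula. -/
noncomputable def jacobiP (α β : ℝ) (n : ℕ) : ℝ → ℝ := fun x =>
  ((-1 : ℝ) ^ n / ((2 : ℝ) ^ n * (Nat.factorial n : ℝ)))
    * (1 - x) ^ (-α) * (1 + x) ^ (-β)
    * deriv^[n] (fun t => (1 - t) ^ ((n : ℝ) + α) * (1 + t) ^ ((n : ℝ) + β)) x


open Polynomial in
/-- The weighted integral functional. -/
noncomputable def jacL (a b : ℝ) (f : ℝ[X]) : ℝ :=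
  ∫ t in (-1 : ℝ)..1, (1 - t) ^ a * (1 + t) ^ b * f.eval t

lemma jac_weight_integrable {a b : ℝ} (ha : -1 < a) (hb : -1 < b) :
    IntervalIntegrable (fun t : ℝ => (1 - t) ^ a * (1 + t) ^ b) volume (-1) 1 := by
  have h1 : IntervalIntegrable (fun t : ℝ => (1 + t) ^ b) volume (-1) 0 := by
    have := (intervalIntegral.intervalIntegrable_rpow' (a := 0) (b := 1) hb).comp_add_left 1
    simpa using this
  have h2 : IntervalIntegrable (fun t : ℝ => (1 - t) ^ a) volume 0 1 := by
    have := (intervalIntegral.intervalIntegrable_rpow' (a := 1) (b := 0) ha).comp_sub_left 1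
    simpa using this
  refine IntervalIntegrable.trans (b := 0) ?_ ?_
  · refine h1.continuousOn_mul ?_
    intro t ht
    rw [Set.uIcc_of_le (by norm_num)] at ht
    have : (1 - t) ≠ 0 := by linarith [ht.2]
    exact (ContinuousAt.rpow_const (by fun_prop) (Or.inl this)).continuousWithinAt
  · refine h2.mul_continuousOn ?_
    intro t ht
    rw [Set.uIcc_of_le (by norm_num)] at ht
    have : (1 + t) ≠ 0 := by linarith [ht.1]
    exact (ContinuousAt.rpow_const (by fun_prop) (Or.inl this)).continuousWithinAt

open Polynomial in
lemma jac_integrable {a b : ℝ} (ha : -1 < a) (hb : -1 < b) (f : ℝ[X]) :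
    IntervalIntegrable (fun t : ℝ => (1 - t) ^ a * (1 + t) ^ b * f.eval t) volume (-1) 1 :=
  (jac_weight_integrable ha hb).mul_continuousOn f.continuous.continuousOn

open Polynomial in
lemma jacL_add {a b : ℝ} (ha : -1 < a) (hb : -1 < b) (f g : ℝ[X]) :
    jacL a b (f + g) = jacL a b f + jacL a b g := by
  unfold jacL
  rw [← intervalIntegral.integral_add (jac_integrable ha hb f) (jac_integrable ha hb g)]
  congr 1; ext t; simp; ring

open Polynomial in
lemma jacL_C_mul (a b : ℝ) (c : ℝ) (f : ℝ[X]) :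
    jacL a b (C c * f) = c * jacL a b f := by
  unfold jacL
  rw [← intervalIntegral.integral_const_mul]
  congr 1; ext t; simp; ring

open Polynomial in
lemma jacL_sub {a b : ℝ} (ha : -1 < a) (hb : -1 < b) (f g : ℝ[X]) :
    jacL a b (f - g) = jacL a b f - jacL a b g := by
  have := jacL_add ha hb (f - g) g
  rw [sub_add_cancel] at this
  linarith

open Polynomial in
lemma jacL_sigma {a b : ℝ} (f : ℝ[X]) :
    jacL (a + 1) (b + 1) f = jacL a b ((1 - X ^ 2) * f) := by
  unfold jacL
  refine intervalIntegral.integral_congr_Ioo_of_le (by norm_num) ?_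
  intro t ht
  have h1 : 0 < 1 - t := by linarith [ht.2]
  have h2 : 0 < 1 + t := by linarith [ht.1]
  simp only [rpow_add h1, rpow_add h2, rpow_one, eval_mul, eval_sub, eval_one, eval_pow, eval_X]
  ring

lemma jac_hasDerivAt (a b : ℝ) (f : Polynomial ℝ) {t : ℝ} (ht : t ∈ Set.Ioo (-1 : ℝ) 1) :
    HasDerivAt (fun t : ℝ => (1 - t) ^ (a + 1) * (1 + t) ^ (b + 1) * f.eval t)
      ((1 - t) ^ a * (1 + t) ^ b *
        (((b + 1) * (1 - t) - (a + 1) * (1 + t)) * f.eval t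
          + (1 - t ^ 2) * f.derivative.eval t)) t := by
  have h1 : 0 < 1 - t := by linarith [ht.2]
  have h2 : 0 < 1 + t := by linarith [ht.1]
  have d1 : HasDerivAt (fun t : ℝ => (1 - t) ^ (a + 1)) (-1 * (a + 1) * (1 - t) ^ (a + 1 - 1)) t :=
    HasDerivAt.rpow_const (by simpa using (hasDerivAt_id t).const_sub 1) (Or.inl h1.ne')
  have d2 : HasDerivAt (fun t : ℝ => (1 + t) ^ (b + 1)) (1 * (b + 1) * (1 + t) ^ (b + 1 - 1)) t :=
    HasDerivAt.rpow_const (by simpa using (hasDerivAt_id t).const_add 1) (Or.inl h2.ne')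
  have := (d1.mul d2).mul (f.hasDerivAt t)
  refine this.congr_deriv ?_
  simp only [add_sub_cancel_right, rpow_add h1, rpow_add h2, rpow_one, Pi.mul_apply]
  ring

open Polynomial in
/-- The operator giving the derivative of weight times polynomial. -/
noncomputable def jacD (a b : ℝ) (f : ℝ[X]) : ℝ[X] :=
  (C (b + 1) * (1 - X) - C (a + 1) * (1 + X)) * f + (1 - X ^ 2) * derivative f

lemma jacL_D {a b : ℝ} (ha : -1 < a) (hb : -1 < b) (f : Polynomial ℝ) :
    jacL a b (jacD a b f) = 0 := by
  have key := intervalIntegral.integral_eq_sub_of_hasDerivAt_of_le (a := -1) (b := 1)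
    (f := fun t : ℝ => (1 - t) ^ (a + 1) * (1 + t) ^ (b + 1) * f.eval t)
    (f' := fun t => (1 - t) ^ a * (1 + t) ^ b * (jacD a b f).eval t) (by norm_num) ?_ ?_
    (jac_integrable ha hb _)
  · unfold jacL
    rw [key]
    have e1 : (0 : ℝ) ^ (a + 1) = 0 := zero_rpow (by linarith)
    have e2 : (0 : ℝ) ^ (b + 1) = 0 := zero_rpow (by linarith)
    simp [e1, e2]
  · apply Continuous.continuousOn
    refine Continuous.mul (Continuous.mul ?_ ?_) f.continuous
    · exact Continuous.rpow_const (by fun_prop) (fun _ => Or.inr (by linarith))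
    · exact Continuous.rpow_const (by fun_prop) (fun _ => Or.inr (by linarith))
  · intro t ht
    simpa [jacD] using jac_hasDerivAt a b f ht

lemma jac_beta {a b : ℝ} (ha : -1 < a) (hb : -1 < b) :
    jacL a b 1 = 2 ^ (a + b + 1) * (Gamma (a + 1) * Gamma (b + 1) / Gamma (a + b + 2)) := by
  have h := Complex.betaIntegral_scaled ((b + 1 : ℝ) : ℂ) ((a + 1 : ℝ) : ℂ) (a := 2) (by norm_num)
  rw [Complex.betaIntegral_eq_Gamma_mul_div _ _ (by simp; linarith) (by simp; linarith)] at h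
  have h0 : (∫ x in (0:ℝ)..2, (x : ℂ) ^ (((b + 1 : ℝ) : ℂ) - 1) * (((2 : ℝ) : ℂ) - x) ^ (((a + 1 : ℝ) : ℂ) - 1))
      = ((∫ x in (0:ℝ)..2, x ^ b * (2 - x) ^ a : ℝ) : ℂ) := by
    rw [← intervalIntegral.integral_ofReal]
    refine intervalIntegral.integral_congr_Ioo_of_le (by norm_num) ?_
    intro t ht
    have h1 : 0 ≤ 2 - t := by linarith [ht.2]
    have h2 : 0 ≤ t := by linarith [ht.1]
    simp only
    rw [Complex.ofReal_mul, Complex.ofReal_cpow h1, Complex.ofReal_cpow h2]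
    push_cast
    simp
  rw [h0, ← Complex.ofReal_add, Complex.Gamma_ofReal, Complex.Gamma_ofReal, Complex.Gamma_ofReal,
    show (((b + 1 + (a + 1) : ℝ) : ℂ) - 1) = ((a + b + 1 : ℝ) : ℂ) by push_cast; ring,
    ← Complex.ofReal_cpow (by norm_num)] at h
  norm_cast at h
  have h3 : jacL a b 1 = ∫ x in (0:ℝ)..2, x ^ b * (2 - x) ^ a := by
    unfold jacL
    have := intervalIntegral.integral_comp_add_left (a := -1) (b := 1)
      (fun x : ℝ => x ^ b * (2 - x) ^ a) 1
    norm_num at this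
    rw [← this]
    congr 1; ext t
    simp
    rw [show 2 - (1 + t) = 1 - t by ring]; ring
  rw [h3, h, show b + 1 + (a + 1) = a + b + 2 by ring]
  ring

open Polynomial in
lemma coeff_X_mul_derivative (f : ℝ[X]) (m : ℕ) :
    (X * derivative f).coeff m = m * f.coeff m := by
  cases m with
  | zero => simp
  | succ m => rw [coeff_X_mul, coeff_derivative]; push_cast; ring

open Polynomial in
lemma coeff_sigma_derivative (f : ℝ[X]) (m : ℕ) :
    ((1 - X ^ 2) * derivative f).coeff (m + 1)
      = (m + 2) * f.coeff (m + 2) - m * f.coeff m := by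
  have : (1 - X ^ 2) * derivative f = derivative f - X * (X * derivative f) := by ring
  rw [this, coeff_sub, coeff_X_mul, coeff_X_mul_derivative, coeff_derivative]
  push_cast; ring

open Polynomial in
lemma coeff_jacD (a b : ℝ) (f : ℝ[X]) (m : ℕ) :
    (jacD a b f).coeff (m + 1) = (b - a) * f.coeff (m + 1) - (a + b + 2 + m) * f.coeff m
      + (m + 2) * f.coeff (m + 2) := by
  have : (C (b + 1) * (1 - X) - C (a + 1) * (1 + X)) * f
      = C (b - a) * f - C (a + b + 2) * (X * f) := by
    simp only [map_add, map_sub, map_one, C_ofNat]; ring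
  rw [jacD, coeff_add, coeff_sigma_derivative, this, coeff_sub, coeff_C_mul, coeff_C_mul,
    coeff_X_mul]
  ring

open Polynomial in
lemma natDegree_jacD (a b : ℝ) (f : ℝ[X]) (k : ℕ) (hf : f.natDegree ≤ k) :
    (jacD a b f).natDegree ≤ k + 1 := by
  rw [natDegree_le_iff_coeff_eq_zero]
  intro m hm
  obtain ⟨m, rfl⟩ : ∃ j, m = j + 1 := ⟨m - 1, by omega⟩
  rw [coeff_jacD, coeff_eq_zero_of_natDegree_lt (by omega), coeff_eq_zero_of_natDegree_lt (by omega),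
    coeff_eq_zero_of_natDegree_lt (by omega)]
  ring

open Polynomial in
lemma jac_core {α β : ℝ} (hα : -1 < α) (hβ : -1 < β) (n : ℕ) (q : ℝ[X]) (hq : q.Monic)
    (hn : q.natDegree = n) (c h : ℝ)
    (H : ∀ g : ℝ[X], g.natDegree ≤ n + 1 →
      jacL α β ((X - C c) * q * g) = g.coeff (n + 1) * h) :
    (1 - c ^ 2) * q.eval c * jacL α β q = (2 * n + α + β + 3) * h := by
  have hqn : q.coeff n = 1 := by rw [← hn]; exact hq
  have hz : ∀ m, n < m → q.coeff m = 0 := fun m hm => coeff_eq_zero_of_natDegree_lt (by omega)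
  -- square of q
  have h1 : jacL α β (q * q) = q.eval c * jacL α β q := by
    have hd := modByMonic_add_div q (X - C c)
    rw [modByMonic_X_sub_C_eq_C_eval] at hd
    set g := q /ₘ (X - C c) with hg
    have hgd : g.natDegree < n + 1 := by
      rw [hg, natDegree_divByMonic _ (monic_X_sub_C c)]; omega
    have e : q * q = C (q.eval c) * q + (X - C c) * q * g := by
      nth_rewrite 1 [← hd]; ring
    rw [e, jacL_add hα hβ, jacL_C_mul, H g hgd.le, coeff_eq_zero_of_natDegree_lt hgd]
    ring
  -- sigma times square
  have h2 : jacL α β ((1 - X ^ 2) * (q * q)) = (1 - c ^ 2) * (q.eval c * jacL α β q) - h := by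
    have e : (1 - X ^ 2) * (q * q) = C (1 - c ^ 2) * (q * q) - (X - C c) * q * (q * (X + C c)) := by
      simp only [map_sub, map_one, map_pow]; ring
    have hdeg : (q * (X + C c)).natDegree ≤ n + 1 := by
      refine natDegree_mul_le.trans ?_
      rw [natDegree_X_add_C, hn]
    have hc : (q * (X + C c)).coeff (n + 1) = 1 := by
      rw [mul_add, coeff_add, coeff_mul_X, hqn, mul_comm, coeff_C_mul, hz _ (by omega)]; ring
    rw [e, jacL_sub hα hβ, jacL_C_mul, h1, H _ hdeg, hc]; ring
  have h3 := jacL_D hα hβ ((X - C c) * q * q)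
  have e3 : jacD α β ((X - C c) * q * q) =
      (X - C c) * q * (jacD α β q + (1 - X ^ 2) * derivative q) + (1 - X ^ 2) * (q * q) := by
    simp only [jacD, derivative_mul, derivative_sub, derivative_X, derivative_C]; ring
  have hdeg : (jacD α β q + (1 - X ^ 2) * derivative q).natDegree ≤ n + 1 := by
    rw [natDegree_le_iff_coeff_eq_zero]
    intro m hm
    obtain ⟨m, rfl⟩ : ∃ j, m = j + 1 := ⟨m - 1, by omega⟩
    rw [coeff_add, coeff_jacD, coeff_sigma_derivative, hz m (by omega), hz (m + 1) (by omega),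
      hz (m + 2) (by omega)]
    ring
  rw [e3, jacL_add hα hβ, h2, H _ hdeg, coeff_add, coeff_jacD, coeff_sigma_derivative, hqn,
    hz (n + 1) (by omega), hz (n + 2) (by omega)] at h3
  linarith

open Polynomial in
/-- Polynomial factors of the successive derivatives in the Rodrigues formula. -/
noncomputable def jacR (A B : ℝ) : ℕ → ℝ[X]
  | 0 => 1
  | k + 1 => jacD (A - (k + 1)) (B - (k + 1)) (jacR A B k)

lemma jacR_natDegree (A B : ℝ) (k : ℕ) : (jacR A B k).natDegree ≤ k := by
  induction k with
  | zero => simp [jacR]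
  | succ k ih => exact natDegree_jacD _ _ _ _ ih

lemma jacR_coeff (A B : ℝ) (k : ℕ) :
    (jacR A B k).coeff k = (-1) ^ k * ∏ i ∈ Finset.range k, (A + B - i) := by
  induction k with
  | zero => simp [jacR]
  | succ k ih =>
    have := jacR_natDegree A B k
    rw [jacR, coeff_jacD, ih, Polynomial.coeff_eq_zero_of_natDegree_lt (by omega),
      Polynomial.coeff_eq_zero_of_natDegree_lt (by omega), Finset.prod_range_succ]
    ring

lemma jacR_deriv (A B : ℝ) (k : ℕ) : ∀ t ∈ Set.Ioo (-1 : ℝ) 1,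
    deriv^[k] (fun t => (1 - t) ^ A * (1 + t) ^ B) t
      = (1 - t) ^ (A - k) * (1 + t) ^ (B - k) * (jacR A B k).eval t := by
  induction k with
  | zero => intro t _; simp [jacR]
  | succ k ih =>
    intro t ht
    rw [Function.iterate_succ_apply']
    have h1 : deriv^[k] (fun t => (1 - t) ^ A * (1 + t) ^ B) =ᶠ[nhds t]
        (fun t => (1 - t) ^ (A - k) * (1 + t) ^ (B - k) * (jacR A B k).eval t) :=
      Filter.eventually_of_mem (isOpen_Ioo.mem_nhds ht) ih
    rw [h1.deriv_eq]
    have := (jac_hasDerivAt (A - (k + 1)) (B - (k + 1)) (jacR A B k) ht).deriv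
    rw [show A - ((k : ℝ) + 1) + 1 = A - k by ring, show B - ((k : ℝ) + 1) + 1 = B - k by ring] at this
    rw [this]
    simp [jacR, jacD]
    left; left; ring

open Polynomial in
lemma jacR_integral (A B : ℝ) (k : ℕ) (hA : -1 < A - k) (hB : -1 < B - k) (f : ℝ[X]) :
    jacL (A - k) (B - k) (jacR A B k * f) = (-1) ^ k * jacL A B (derivative^[k] f) := by
  induction k generalizing f with
  | zero => simp [jacR]
  | succ k ih =>
    push_cast at hA hB ⊢
    have e : jacR A B (k + 1) * f = jacD (A - (k + 1)) (B - (k + 1)) (jacR A B k * f)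
        - (1 - X ^ 2) * (jacR A B k * derivative f) := by
      simp only [jacR, jacD, derivative_mul]; ring
    rw [e, jacL_sub hA hB, jacL_D hA hB, ← jacL_sigma,
      show A - ((k : ℝ) + 1) + 1 = A - k by ring, show B - ((k : ℝ) + 1) + 1 = B - k by ring,
      ih (by linarith) (by linarith), Function.iterate_succ_apply]
    ring

open Polynomial in
lemma iterate_derivative_top (N : ℕ) (g : ℝ[X]) (hg : g.natDegree ≤ N) :
    derivative^[N] g = C ((N.factorial : ℝ) * g.coeff N) * 1 := by
  ext m
  rw [coeff_iterate_derivative, mul_one, coeff_C]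
  split_ifs with h
  · subst h; simp [Nat.descFactorial_self]
  · rw [coeff_eq_zero_of_natDegree_lt (by omega)]; simp

lemma gamma_prod (s : ℝ) (hs : 0 < s) (N : ℕ) :
    Gamma (s + N) = (∏ i ∈ Finset.range N, (s + N - 1 - i)) * Gamma s := by
  induction N generalizing s with
  | zero => simp
  | succ N ih =>
    have h := ih (s + 1) (by linarith)
    rw [Gamma_add_one hs.ne'] at h
    rw [Finset.prod_range_succ]
    push_cast
    rw [show s + ((N : ℝ) + 1) = s + 1 + N by ring, h]
    ring

lemma jac_sign (n : ℕ) (x : Fin (n + 1) → ℝ) (hx : StrictMono x) (j : Fin (n + 1)) :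
    0 < (-1 : ℝ) ^ (n + (j : ℕ)) * ∏ k ∈ Finset.univ.erase j, (x j - x k) := by
  have hs : (Finset.univ.erase j) = Finset.Iio j ∪ Finset.Ioi j := by
    ext k; simp only [Finset.mem_erase, Finset.mem_univ, and_true, Finset.mem_union,
      Finset.mem_Iio, Finset.mem_Ioi]
    exact lt_or_lt_iff_ne.symm
  have hd : Disjoint (Finset.Iio j) (Finset.Ioi j) := by
    rw [Finset.disjoint_left]; intro k h1 h2
    simp only [Finset.mem_Iio, Finset.mem_Ioi] at h1 h2
    exact lt_asymm h1 h2
  rw [hs, Finset.prod_union hd]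
  have e : ∏ k ∈ Finset.Ioi j, (x j - x k) = (-1) ^ (n - (j : ℕ)) * ∏ k ∈ Finset.Ioi j, (x k - x j) := by
    have : ∀ k ∈ Finset.Ioi j, x j - x k = (-1) * (x k - x j) := fun k _ => by ring
    rw [Finset.prod_congr rfl this, Finset.prod_mul_distrib, Finset.prod_const, Fin.card_Ioi]
    congr 2
  have p1 : 0 < ∏ k ∈ Finset.Iio j, (x j - x k) :=
    Finset.prod_pos fun k hk => sub_pos.2 (hx (Finset.mem_Iio.1 hk))
  have p2 : 0 < ∏ k ∈ Finset.Ioi j, (x k - x j) :=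
    Finset.prod_pos fun k hk => sub_pos.2 (hx (Finset.mem_Ioi.1 hk))
  have hj : (j : ℕ) ≤ n := by omega
  have s1 : (-1 : ℝ) ^ (n + (j : ℕ)) * (-1) ^ (n - (j : ℕ)) = 1 := by
    rw [← pow_add, show n + (j : ℕ) + (n - (j : ℕ)) = 2 * n by omega, pow_mul]; simp
  rw [e]
  calc 0 < (∏ k ∈ Finset.Iio j, (x j - x k)) * ∏ k ∈ Finset.Ioi j, (x k - x j) := mul_pos p1 p2
    _ = ((-1 : ℝ) ^ (n + (j : ℕ)) * (-1) ^ (n - (j : ℕ))) *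
      ((∏ k ∈ Finset.Iio j, (x j - x k)) * ∏ k ∈ Finset.Ioi j, (x k - x j)) := by rw [s1, one_mul]
    _ = _ := by ring

open Polynomial in
lemma jac_factor (α β : ℝ) (n : ℕ) (x : Fin (n + 1) → ℝ)
    (hx_mono : StrictMono x)
    (hx_mem : ∀ j, x j ∈ Set.Ioo (-1 : ℝ) 1)
    (hx_root : ∀ j, jacobiP α β (n + 1) (x j) = 0) :
    jacR (((n + 1 : ℕ) : ℝ) + α) (((n + 1 : ℕ) : ℝ) + β) (n + 1)
      = C ((jacR (((n + 1 : ℕ) : ℝ) + α) (((n + 1 : ℕ) : ℝ) + β) (n + 1)).coeff (n + 1))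
        * ∏ k, (X - C (x k)) := by
  set P := jacR (((n + 1 : ℕ) : ℝ) + α) (((n + 1 : ℕ) : ℝ) + β) (n + 1) with hP
  have hPd : P.natDegree ≤ n + 1 := jacR_natDegree _ _ _
  have hroot : ∀ j, P.eval (x j) = 0 := by
    intro j
    have h := hx_root j
    have h1 : 0 < 1 - x j := by linarith [(hx_mem j).2]
    have h2 : 0 < 1 + x j := by linarith [(hx_mem j).1]
    unfold jacobiP at h
    rw [jacR_deriv _ _ _ _ (hx_mem j)] at h
    have a1 := (rpow_pos_of_pos h1 (-α)).ne'
    have a2 := (rpow_pos_of_pos h2 (-β)).ne'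
    have a3 := (rpow_pos_of_pos h1 (((n + 1 : ℕ) : ℝ) + α - ((n + 1 : ℕ) : ℝ))).ne'
    have a4 := (rpow_pos_of_pos h2 (((n + 1 : ℕ) : ℝ) + β - ((n + 1 : ℕ) : ℝ))).ne'
    have a5 : ((-1 : ℝ) ^ (n + 1) / ((2 : ℝ) ^ (n + 1) * (Nat.factorial (n + 1) : ℝ))) ≠ 0 := by
      have : (Nat.factorial (n + 1) : ℝ) ≠ 0 := by positivity
      refine div_ne_zero (pow_ne_zero _ (by norm_num)) (mul_ne_zero (by positivity) this)
    rcases mul_eq_zero.1 h with h | h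
    · exact absurd h (mul_ne_zero (mul_ne_zero a5 a1) a2)
    · rcases mul_eq_zero.1 h with h | h
      · exact absurd h (mul_ne_zero a3 a4)
      · exact h
  have hm : (∏ k, (X - C (x k))).Monic := monic_prod_of_monic _ _ fun k _ => monic_X_sub_C _
  have hmd : (∏ k, (X - C (x k))).natDegree = n + 1 := by
    rw [natDegree_prod_of_monic _ _ fun k _ => monic_X_sub_C _]; simp
  have hmc : (∏ k, (X - C (x k))).coeff (n + 1) = 1 := by
    have h := hm.coeff_natDegree
    rwa [hmd] at h
  rw [← sub_eq_zero]
  refine eq_zero_of_natDegree_lt_card_of_eval_eq_zero _ hx_mono.injective ?_ ?_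
  · intro j
    rw [eval_sub, hroot, eval_mul, eval_prod, Finset.prod_eq_zero (Finset.mem_univ j) (by simp)]
    simp
  · rw [Fintype.card_fin, Nat.lt_succ_iff, natDegree_le_iff_coeff_eq_zero]
    intro m hmm
    rw [coeff_sub, coeff_C_mul]
    rcases Nat.lt_or_ge (n + 1) m with h | h
    · rw [coeff_eq_zero_of_natDegree_lt (lt_of_le_of_lt hPd h),
        coeff_eq_zero_of_natDegree_lt (lt_of_eq_of_lt hmd h)]; simp
    · have : m = n + 1 := by omega
      subst this
      rw [hmc]; ring

/-- **Corollary 2.3: barycentric weights for Gauss–Jacobi points.**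
If `x_0 < ⋯ < x_n` are the roots of `P_{n+1}^{(α,β)}` then
`λ_j = (-1)^{n+j} C_n^{(α,β)} √((1-x_j²) w_j)` with the explicit constant
`C_n^{(α,β)} = Γ(2n+α+β+3) / (2^{n+1+(α+β+1)/2} √((n+1)! Γ(n+α+β+2) Γ(n+α+2) Γ(n+β+2)))`. -/
theorem barycentric_jacobi
    (α β : ℝ) (hα : -1 < α) (hβ : -1 < β)
    (n : ℕ) (x : Fin (n + 1) → ℝ)
    (hx_mono : StrictMono x)
    (hx_mem : ∀ j, x j ∈ Set.Ioo (-1 : ℝ) 1)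
    (hx_root : ∀ j, jacobiP α β (n + 1) (x j) = 0)
    (lam w : Fin (n + 1) → ℝ)
    (hlam : ∀ j, lam j = (∏ k ∈ Finset.univ.erase j, (x j - x k))⁻¹)
    (hw : ∀ j, w j = ∫ t in (-1 : ℝ)..1, (1 - t) ^ α * (1 + t) ^ β
      * ∏ k ∈ Finset.univ.erase j, ((t - x k) / (x j - x k))) :
    ∀ j : Fin (n + 1),
      lam j = (-1 : ℝ) ^ (n + (j : ℕ))
        * (Real.Gamma (2 * (n : ℝ) + α + β + 3)
            / ((2 : ℝ) ^ ((n : ℝ) + 1 + (α + β + 1) / 2)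
              * Real.sqrt ((Nat.factorial (n + 1) : ℝ)
                  * Real.Gamma ((n : ℝ) + α + β + 2)
                  * Real.Gamma ((n : ℝ) + α + 2)
                  * Real.Gamma ((n : ℝ) + β + 2))))
        * Real.sqrt ((1 - (x j) ^ 2) * w j) := by
  
  intro j
  set N : ℝ := ((n + 1 : ℕ) : ℝ) with hN
  have hN' : N = n + 1 := by rw [hN]; push_cast; ring
  have hn0 : (0 : ℝ) ≤ n := Nat.cast_nonneg n
  set s : ℝ := n + α + β + 2 with hs
  have hs0 : 0 < s := by rw [hs]; linarith
  have hGs : 0 < Gamma s := Gamma_pos_of_pos hs0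
  have hGN : 0 < Gamma (s + N) := Gamma_pos_of_pos (by linarith)
  have hGa : 0 < Gamma (n + α + 2) := Gamma_pos_of_pos (by linarith)
  have hGb : 0 < Gamma (n + β + 2) := Gamma_pos_of_pos (by linarith)
  have hf : (0 : ℝ) < ((n + 1).factorial : ℝ) := by positivity
  set P := jacR (N + α) (N + β) (n + 1) with hP
  have hfac := jac_factor α β n x hx_mono hx_mem hx_root
  rw [← hN, ← hP] at hfac
  have hl : P.coeff (n + 1) = (-1) ^ (n + 1) * (Gamma (s + N) / Gamma s) := by
    rw [hP, jacR_coeff]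
    have h := gamma_prod s hs0 (n + 1)
    rw [← hN] at h
    rw [h, mul_div_cancel_right₀ _ hGs.ne']
    congr 1
    refine Finset.prod_congr rfl fun i _ => ?_
    rw [hN', hs]; ring
  set q : Polynomial ℝ := ∏ k ∈ Finset.univ.erase j, (Polynomial.X - Polynomial.C (x k)) with hq
  have hprod : ∏ k, (Polynomial.X - Polynomial.C (x k)) = (Polynomial.X - Polynomial.C (x j)) * q :=
    (Finset.mul_prod_erase _ _ (Finset.mem_univ j)).symm
  have hqm : q.Monic := Polynomial.monic_prod_of_monic _ _ fun k _ => Polynomial.monic_X_sub_C _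
  have hqd : q.natDegree = n := by
    rw [hq, Polynomial.natDegree_prod_of_monic _ _ fun k _ => Polynomial.monic_X_sub_C _]; simp
  have hqe : ∀ t, q.eval t = ∏ k ∈ Finset.univ.erase j, (t - x k) := by
    intro t; rw [hq, Polynomial.eval_prod]; simp
  set B0 := jacL (N + α) (N + β) 1 with hB0
  have core := jac_core hα hβ n q hqm hqd (x j)
    (((n + 1).factorial : ℝ) * B0 * Gamma s / Gamma (s + N)) (by
      intro g hg
      have h := jacR_integral (N + α) (N + β) (n + 1) (by rw [← hN]; linarith)
        (by rw [← hN]; linarith) g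
      rw [← hN, iterate_derivative_top _ _ hg, jacL_C_mul, ← hP, hfac, hprod,
        add_sub_cancel_left, add_sub_cancel_left, ← hB0, mul_assoc, jacL_C_mul, hl] at h
      have hpm : ((-1 : ℝ) ^ (n + 1)) ≠ 0 := pow_ne_zero _ (by norm_num)
      rw [mul_assoc] at h
      have h' := mul_left_cancel₀ hpm h
      field_simp at h' ⊢
      linarith)
  set Q := q.eval (x j) with hQ
  have hsign : 0 < (-1 : ℝ) ^ (n + (j : ℕ)) * Q := by
    rw [hQ, hqe]; exact jac_sign n x hx_mono j
  set e : ℝ := (-1 : ℝ) ^ (n + (j : ℕ)) with he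
  have hee : e * e = 1 := by
    rw [he, ← mul_pow]; simp
  have hQ0 : Q ≠ 0 := by rintro h; rw [h, mul_zero] at hsign; exact lt_irrefl _ hsign
  have hlamj : lam j = Q⁻¹ := by rw [hlam, hQ, hqe]
  have hwj : jacL α β q = w j * Q := by
    rw [hw, jacL, ← intervalIntegral.integral_mul_const]
    congr 1; ext t
    rw [Finset.prod_div_distrib, ← hqe, ← hqe, ← hQ]
    field_simp
  rw [hwj] at core
  have hB : B0 = 2 ^ (2 * n + α + β + 3) *
      (Gamma (n + α + 2) * Gamma (n + β + 2) / Gamma (2 * n + α + β + 4)) := by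
    rw [hB0, jac_beta (by linarith) (by linarith), hN']
    ring_nf
  have hsN : s + N = 2 * n + α + β + 3 := by rw [hs, hN']; ring
  rw [hsN] at core hGN
  have hG4 : Gamma (2 * n + α + β + 4) = (2 * n + α + β + 3) * Gamma (2 * n + α + β + 3) := by
    rw [← Gamma_add_one (by linarith)]; ring_nf
  set G := Gamma (2 * n + α + β + 3) with hG
  have hpos3 : (0 : ℝ) < 2 * n + α + β + 3 := by linarith
  set D := ((n + 1).factorial : ℝ) * Gamma s * Gamma (n + α + 2) * Gamma (n + β + 2) with hD
  have hD0 : 0 < D := by positivity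
  set T : ℝ := (2 : ℝ) ^ ((n : ℝ) + 1 + (α + β + 1) / 2) with hT
  have hT0 : 0 < T := by positivity
  have hT2 : (2 : ℝ) ^ (2 * n + α + β + 3) = T ^ 2 := by
    rw [hT, ← rpow_natCast, ← rpow_mul (by norm_num)]; congr 1; push_cast; ring
  have hW : (1 - x j ^ 2) * w j = (T * sqrt D / (G * (e * Q))) ^ 2 := by
    rw [div_pow, mul_pow, sq_sqrt hD0.le, mul_pow, mul_pow, show e ^ 2 = 1 by rw [sq, hee], one_mul,
      eq_div_iff (by positivity)]
    rw [hB, hG4, hT2] at core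
    have : (1 - x j ^ 2) * w j * Q ^ 2 = T ^ 2 * D / G ^ 2 := by
      calc _ = (1 - x j ^ 2) * Q * (w j * Q) := by ring
        _ = _ := by rw [core, hD]; field_simp
    calc _ = ((1 - x j ^ 2) * w j * Q ^ 2) * G ^ 2 := by ring
      _ = _ := by rw [this]; field_simp
  rw [hW, sqrt_sq (by positivity), hlamj]
  have hsD : 0 < sqrt D := sqrt_pos.2 hD0
  have he0 : e ≠ 0 := by rintro h; rw [h] at hee; norm_num at hee
  field_simp
end

section
/- Let α, β > −1 and let x_0 < ⋯ < x_n be the n+1 roots of the Jacobi polynomial P_{n+1}^{(α+1,β+1)}, with Gauss–Jacobi quadrature weights w_j := ∫_{−1}^1 (1−x)^{α+1}(1+x)^{β+1} ∏_{k≠j}((x − x_k)/(x_j − x_k)) dx, and set w̃_j := w_j/(1 − x_j²). Define C := (−1)^n Γ(2n+α+β+5) / ( 2^{n+1+(α+β+3)/2} √( (n+1)! Γ(n+α+β+4) Γ(n+α+3) Γ(n+β+3) ) ), ŵ_1 := 2^{α+β+1} Γ(β+1)Γ(β+2)Γ(n+α+3)(n+1)! / ( Γ(n+β+3) Γ(n+α+β+4)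 ), and ŵ_2 := 2^{α+β+1} Γ(α+1)Γ(α+2)Γ(n+β+3)(n+1)! / ( Γ(n+α+3) Γ(n+α+β+4) ). Consider the combined node set {−1, 1} ∪ {x_0,…,x_n}, with barycentric weights λ̃_j at x_j, λ̂_1 at −1 and λ̂_2 at +1. Then λ̃_j = C (−1)^{j+1} √(w̃_j) for j = 0,…,n, λ̂_1 = C √((β+1) ŵ_1), and λ̂_2 = C (−1)^n √((α+1) ŵ_2). -/
open MeasureTheory Finset Real

namespace JacLob
open Polynomial

/-- The differential operator attached to `(1-x)^A (1+x)^B`. -/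
noncomputable def T (A B : ℝ) (q : ℝ[X]) : ℝ[X] :=
  (1 - X ^ 2) * derivative q + (C B * (1 - X) - C A * (1 + X)) * q

/-- Unnormalised Jacobi polynomial. -/
noncomputable def J : ℕ → ℝ → ℝ → ℝ[X]
  | 0, _, _ => 1
  | (k + 1), a, b => T (a + 1) (b + 1) (J k (a + 1) (b + 1))

/-- Integration functional. -/
noncomputable def L (a b : ℝ) (p : ℝ[X]) : ℝ :=
  ∫ t in (-1 : ℝ)..1, (1 - t) ^ a * (1 + t) ^ b * p.eval t

lemma cont_W {a b : ℝ} (ha : 0 ≤ a) (hb : 0 ≤ b) (p : ℝ[X]) :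
    Continuous (fun t : ℝ => (1 - t) ^ a * (1 + t) ^ b * p.eval t) := by
  have h1 : Continuous (fun t : ℝ => (1 - t) ^ a) :=
    (continuous_const.sub continuous_id).rpow_const (fun _ => Or.inr ha)
  have h2 : Continuous (fun t : ℝ => (1 + t) ^ b) :=
    (continuous_const.add continuous_id).rpow_const (fun _ => Or.inr hb)
  exact (h1.mul h2).mul p.continuous

lemma L_add {a b : ℝ} (ha : 0 ≤ a) (hb : 0 ≤ b) (p q : ℝ[X]) :
    L a b (p + q) = L a b p + L a b q := by
  unfold L
  rw [← intervalIntegral.integral_add ((cont_W ha hb p).intervalIntegrable _ _)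
    ((cont_W ha hb q).intervalIntegrable _ _)]
  congr 1; ext t; rw [eval_add]; ring

lemma L_C_mul {a b : ℝ} (c : ℝ) (p : ℝ[X]) :
    L a b (C c * p) = c * L a b p := by
  unfold L
  rw [← intervalIntegral.integral_const_mul]
  congr 1; ext t; rw [eval_mul, eval_C]; ring

lemma hasDeriv_W (A B : ℝ) (q : ℝ[X]) {t : ℝ} (ht : t ∈ Set.Ioo (-1 : ℝ) 1) :
    HasDerivAt (fun t : ℝ => (1 - t) ^ (A + 1) * (1 + t) ^ (B + 1) * q.eval t)
      ((1 - t) ^ A * (1 + t) ^ B * (T (A + 1) (B + 1) q).eval t) t := by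
  have h1 : 0 < 1 - t := by linarith [ht.2]
  have h2 : 0 < 1 + t := by linarith [ht.1]
  have e1 : HasDerivAt (fun t : ℝ => (1 - t) ^ (A + 1)) (-1 * (A + 1) * (1 - t) ^ (A + 1 - 1)) t :=
    ((hasDerivAt_id t).const_sub 1).rpow_const (Or.inl h1.ne')
  have e2 : HasDerivAt (fun t : ℝ => (1 + t) ^ (B + 1)) (1 * (B + 1) * (1 + t) ^ (B + 1 - 1)) t :=
    ((hasDerivAt_id t).const_add 1).rpow_const (Or.inl h2.ne')
  refine ((e1.mul e2).mul (q.hasDerivAt t)).congr_deriv ?_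
  simp only [T, add_sub_cancel_right, Pi.mul_apply, rpow_add_one h1.ne', rpow_add_one h2.ne', eval_add, eval_mul,
    eval_sub, eval_one, eval_pow, eval_X, eval_C]
  ring

lemma L_T {A B : ℝ} (hA : 0 ≤ A) (hB : 0 ≤ B) (q : ℝ[X]) :
    L A B (T (A + 1) (B + 1) q) = 0 := by
  unfold L
  rw [intervalIntegral.integral_eq_sub_of_hasDerivAt_of_le (by norm_num)
    (cont_W (a := A + 1) (b := B + 1) (by linarith) (by linarith) q).continuousOn
    (fun t ht => hasDeriv_W A B q ht) ((cont_W hA hB _).intervalIntegrable _ _)]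
  rw [show (1 : ℝ) - 1 = 0 by norm_num, show (1 : ℝ) + (-1) = 0 by norm_num,
    zero_rpow (by linarith), zero_rpow (by linarith)]
  simp

lemma L_shift {A B : ℝ} (p : ℝ[X]) :
    L A B ((1 - X ^ 2) * p) = L (A + 1) (B + 1) p := by
  unfold L
  rw [intervalIntegral.integral_of_le (by norm_num), intervalIntegral.integral_of_le (by norm_num),
    integral_Ioc_eq_integral_Ioo, integral_Ioc_eq_integral_Ioo]
  apply setIntegral_congr_fun measurableSet_Ioo
  intro t ht
  have h1 : 0 < 1 - t := by linarith [ht.2]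
  have h2 : 0 < 1 + t := by linarith [ht.1]
  simp only [rpow_add_one h1.ne', rpow_add_one h2.ne', eval_mul,
    eval_sub, eval_one, eval_pow, eval_X]
  ring

lemma T_mul (A B : ℝ) (q f : ℝ[X]) :
    T A B (q * f) = T A B q * f + (1 - X ^ 2) * (q * derivative f) := by
  unfold T; rw [derivative_mul]; ring

lemma T_deg (A B : ℝ) {q : ℝ[X]} {k : ℕ} (hq : q.natDegree ≤ k) :
    (T A B q).natDegree ≤ k + 1 ∧
      (T A B q).coeff (k + 1) = -((k : ℝ) + A + B) * q.coeff k := by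
  have hc : ∀ m, k < m → q.coeff m = 0 := fun m hm => coeff_eq_zero_of_natDegree_lt (by omega)
  have hT : T A B q = derivative q - derivative q * X ^ 2 + C (B - A) * q - C (A + B) * (q * X) := by
    unfold T; simp only [C_sub, C_add]; ring
  rw [hT]
  constructor
  · rw [natDegree_le_iff_coeff_eq_zero]
    intro m hm
    obtain ⟨m, rfl⟩ : ∃ r, m = r + 2 := ⟨m - 2, by omega⟩
    simp only [coeff_add, coeff_sub, coeff_mul_X_pow, coeff_C_mul, coeff_derivative]
    rw [show m + 2 = (m + 1) + 1 from rfl, coeff_mul_X, hc _ (by omega : k < m + 1 + 1 + 1),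
      hc _ (by omega : k < m + 1), hc _ (by omega : k < m + 1 + 1)]
    simp
  · simp only [coeff_add, coeff_sub, coeff_C_mul, coeff_mul_X, coeff_derivative]
    rw [hc _ (by omega : k < k + 1 + 1), hc _ (by omega : k < k + 1)]
    rcases k with _ | k
    · simp [coeff_mul_X_pow']; ring
    · rw [show k + 1 + 1 = k + 2 from rfl, coeff_mul_X_pow, coeff_derivative]
      push_cast; ring

lemma J_deg (N : ℕ) : ∀ a b : ℝ, (J N a b).natDegree ≤ N := by
  induction N with
  | zero => intro a b; simp [J]
  | succ k ih => intro a b; exact (T_deg _ _ (ih _ _)).1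

lemma J_coeff (N : ℕ) : ∀ a b : ℝ, 0 < a → 0 < b →
    (J N a b).coeff N * Gamma (N + a + b + 1) = (-1) ^ N * Gamma (2 * N + a + b + 1) := by
  induction N with
  | zero => intro a b _ _; simp [J]
  | succ k ih =>
    intro a b ha hb
    have h := ih (a + 1) (b + 1) (by linarith) (by linarith)
    rw [J, (T_deg _ _ (J_deg k _ _)).2]
    have e : Gamma ((k : ℝ) + (a + 1) + (b + 1) + 1)
        = ((k : ℝ) + (a + 1) + (b + 1)) * Gamma ((k : ℝ) + (a + 1) + (b + 1)) :=
      Gamma_add_one (by positivity)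
    rw [e] at h
    push_cast
    rw [show (k : ℝ) + 1 + a + b + 1 = (k : ℝ) + (a + 1) + (b + 1) by ring,
      show 2 * ((k : ℝ) + 1) + a + b + 1 = 2 * (k : ℝ) + (a + 1) + (b + 1) + 1 by ring, pow_succ]
    linear_combination (-1) * h

lemma J_one (N : ℕ) : ∀ a b : ℝ, 0 < a → 0 < b →
    (J N a b).eval 1 * Gamma (a + 1) = (-2) ^ N * Gamma (N + a + 1) := by
  induction N with
  | zero => intro a b _ _; simp [J]
  | succ k ih =>
    intro a b ha hb
    have h := ih (a + 1) (b + 1) (by linarith) (by linarith)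
    have e : Gamma (a + 1 + 1) = (a + 1) * Gamma (a + 1) := Gamma_add_one (by positivity)
    rw [e] at h
    simp only [J, T, eval_add, eval_mul, eval_sub, eval_one, eval_pow, eval_X, eval_C]
    push_cast
    rw [show (k : ℝ) + 1 + a + 1 = (k : ℝ) + (a + 1) + 1 by ring, pow_succ]
    linear_combination (-2) * h

lemma J_neg_one (N : ℕ) : ∀ a b : ℝ, 0 < a → 0 < b →
    (J N a b).eval (-1) * Gamma (b + 1) = 2 ^ N * Gamma (N + b + 1) := by
  induction N with
  | zero => intro a b _ _; simp [J]
  | succ k ih =>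
    intro a b ha hb
    have h := ih (a + 1) (b + 1) (by linarith) (by linarith)
    have e : Gamma (b + 1 + 1) = (b + 1) * Gamma (b + 1) := Gamma_add_one (by positivity)
    rw [e] at h
    simp only [J, T, eval_add, eval_mul, eval_sub, eval_one, eval_pow, eval_X, eval_C]
    push_cast
    rw [show (k : ℝ) + 1 + b + 1 = (k : ℝ) + (b + 1) + 1 by ring, pow_succ]
    linear_combination 2 * h

lemma J_rodrigues (N : ℕ) : ∀ a b : ℝ, ∀ t ∈ Set.Ioo (-1 : ℝ) 1,
    deriv^[N] (fun t => (1 - t) ^ ((N : ℝ) + a) * (1 + t) ^ ((N : ℝ) + b)) t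
      = (1 - t) ^ a * (1 + t) ^ b * (J N a b).eval t := by
  induction N with
  | zero => intro a b t _; simp [J]
  | succ k ih =>
    intro a b t ht
    rw [Function.iterate_succ_apply']
    have h := ih (a + 1) (b + 1)
    have e : (fun t : ℝ => (1 - t) ^ (((k + 1 : ℕ) : ℝ) + a) * (1 + t) ^ (((k + 1 : ℕ) : ℝ) + b))
        = (fun t : ℝ => (1 - t) ^ ((k : ℝ) + (a + 1)) * (1 + t) ^ ((k : ℝ) + (b + 1))) := by
      ext t; push_cast; congr 2 <;> ring
    rw [e, J]
    have := (hasDeriv_W a b (J k (a + 1) (b + 1)) ht).deriv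
    rw [← this]
    apply Filter.EventuallyEq.deriv_eq
    filter_upwards [isOpen_Ioo.mem_nhds ht] with s hs using h s hs

lemma J_orth (N : ℕ) : ∀ a b : ℝ, 0 ≤ a → 0 ≤ b → ∀ f : ℝ[X], f.natDegree ≤ N →
    L a b (J N a b * f) = (-1) ^ N * (N.factorial : ℝ) * f.coeff N * L (N + a) (N + b) 1 := by
  induction N with
  | zero =>
    intro a b ha hb f hf
    rw [eq_C_of_natDegree_le_zero hf, J, one_mul, ← mul_one (C _), L_C_mul]
    simp
  | succ k ih =>
    intro a b ha hb f hf
    have h := ih (a + 1) (b + 1) (by linarith) (by linarith) (derivative f)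
      ((natDegree_derivative_le f).trans (by omega))
    have h2 := L_T ha hb (J k (a + 1) (b + 1) * f)
    rw [T_mul, L_add ha hb, L_shift, h, coeff_derivative] at h2
    rw [J, Nat.factorial_succ, pow_succ]
    push_cast
    rw [show (k : ℝ) + 1 + a = k + (a + 1) by ring, show (k : ℝ) + 1 + b = k + (b + 1) by ring]
    linear_combination h2


lemma L_one {A B : ℝ} (hA : 0 < A) (hB : 0 < B) :
    L A B 1 * Gamma (A + B + 2) = 2 ^ (A + B + 1) * Gamma (A + 1) * Gamma (B + 1) := by
  have h0 : L A B 1 = 2 ^ (A + B + 1) * ∫ s in (0 : ℝ)..1, s ^ (B + 1 - 1) * (1 - s) ^ (A + 1 - 1) := by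
    have hs := intervalIntegral.integral_comp_mul_sub
      (fun t : ℝ => (1 - t) ^ A * (1 + t) ^ B * (1 : ℝ[X]).eval t) (a := 0) (b := 1)
      (c := 2) (by norm_num) 1
    norm_num at hs
    unfold L
    have hs2 : (∫ t in (-1 : ℝ)..1, (1 - t) ^ A * (1 + t) ^ B * (1 : ℝ[X]).eval t)
      = 2 * ∫ s in (0 : ℝ)..1, (1 - (2 * s - 1)) ^ A * (2 * s) ^ B := by
      rw [hs]; simp
    rw [hs2, ← intervalIntegral.integral_const_mul, ← intervalIntegral.integral_const_mul]
    apply intervalIntegral.integral_congr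
    intro s hs
    rw [Set.uIcc_of_le (by norm_num)] at hs
    simp only [add_sub_cancel_right]
    rw [show 1 - (2 * s - 1) = 2 * (1 - s) by ring, mul_rpow (by norm_num) (by linarith [hs.2]),
      mul_rpow (by norm_num) hs.1, rpow_add_one (by norm_num), rpow_add (by norm_num)]
    ring
  have h1 := ProbabilityTheory.beta_eq_betaIntegralReal (B + 1) (A + 1) (by linarith) (by linarith)
  have h2 : Complex.betaIntegral ((B + 1 : ℝ) : ℂ) ((A + 1 : ℝ) : ℂ)
      = ((∫ s in (0 : ℝ)..1, s ^ (B + 1 - 1) * (1 - s) ^ (A + 1 - 1) : ℝ) : ℂ) := by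
    rw [Complex.betaIntegral, ← intervalIntegral.integral_ofReal]
    apply intervalIntegral.integral_congr
    intro s hs
    rw [Set.uIcc_of_le (by norm_num)] at hs
    simp only [Complex.ofReal_mul]
    rw [Complex.ofReal_cpow hs.1, Complex.ofReal_cpow (by linarith [hs.2])]
    push_cast
    rfl
  rw [h2, Complex.ofReal_re, ProbabilityTheory.beta] at h1
  rw [h0, ← h1, show B + 1 + (A + 1) = A + B + 2 by ring]
  have : Gamma (A + B + 2) ≠ 0 := (Gamma_pos_of_pos (by linarith)).ne'
  field_simp

lemma key_weight {n : ℕ} {a b h : ℝ} (ha : 0 < a) (hb : 0 < b) (ξ : ℝ) (Q R : ℝ[X])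
    (hQR : Q = (X - C ξ) * R) (hQd : Q.natDegree ≤ n + 1) (hQc : Q.coeff (n + 1) = 1)
    (hRd : R.natDegree ≤ n) (hRc : R.coeff n = 1)
    (horth : ∀ f : ℝ[X], f.natDegree ≤ n + 1 → L a b (Q * f) = h * f.coeff (n + 1)) :
    (1 - ξ ^ 2) * R.eval ξ * L a b R = (2 * ((n : ℝ) + 1) + a + b + 1) * h := by
  have hT := L_T ha.le hb.le (R * Q)
  have hTR := T_deg (a + 1) (b + 1) hRd
  rw [T_mul, L_add ha.le hb.le, mul_comm _ Q, horth _ hTR.1, hTR.2, hRc] at hT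
  have hF := T_deg 0 0 hQd
  have hF0 : T 0 0 Q = (1 - X ^ 2) * derivative Q := by simp [T]
  rw [hF0, hQc] at hF
  set F := (1 - X ^ 2) * derivative Q with hFdef
  have hFe : F.eval ξ = (1 - ξ ^ 2) * R.eval ξ := by
    rw [hFdef, hQR, derivative_mul]; simp
  obtain ⟨g, hg⟩ : (X - C ξ) ∣ F - C (F.eval ξ) := by
    rw [dvd_iff_isRoot]; simp
  have hgd : g.natDegree ≤ n + 1 := by
    by_cases hg0 : g = 0
    · simp [hg0]
    have h1 : (F - C (F.eval ξ)).natDegree ≤ n + 1 + 1 := by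
      refine (natDegree_sub_le _ _).trans ?_
      simpa using hF.1
    rw [hg, natDegree_mul (X_sub_C_ne_zero ξ) hg0, natDegree_X_sub_C] at h1
    omega
  have hgc : g.coeff (n + 1) = -((n : ℝ) + 1) := by
    have h1 : (F - C (F.eval ξ)).coeff (n + 1 + 1) = -((n : ℝ) + 1) := by
      rw [coeff_sub, hF.2, coeff_C_succ]; push_cast; ring
    rw [hg, coeff_X_sub_C_mul, coeff_eq_zero_of_natDegree_lt (p := g) (n := n + 1 + 1) (by omega)] at h1
    linarith
  have hsplit : (1 - X ^ 2) * (R * derivative Q) = C (F.eval ξ) * R + Q * g := by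
    have : F = C (F.eval ξ) + (X - C ξ) * g := by rw [← hg]; ring
    calc (1 - X ^ 2) * (R * derivative Q) = F * R := by rw [hFdef]; ring
      _ = (C (F.eval ξ) + (X - C ξ) * g) * R := by rw [← this]
      _ = _ := by rw [hQR]; ring
  rw [hsplit, L_add ha.le hb.le, L_C_mul, horth g hgd, hgc, hFe] at hT
  linear_combination hT

lemma J_eq (N : ℕ) (a b : ℝ) (x : Fin N → ℝ) (hx : Function.Injective x)
    (hr : ∀ j, (J N a b).eval (x j) = 0) :
    J N a b = C ((J N a b).coeff N) * ∏ k, (X - C (x k)) := by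
  set c := (J N a b).coeff N with hc
  set Q : ℝ[X] := ∏ k, (X - C (x k)) with hQ
  have hQm : Q.Monic := monic_prod_of_monic _ _ (fun k _ => monic_X_sub_C _)
  have hQd : Q.natDegree = N := by
    rw [hQ, natDegree_prod_of_monic _ _ (fun k _ => monic_X_sub_C _)]; simp
  have hz : J N a b - C c * Q = 0 := by
    apply eq_zero_of_degree_lt_of_eval_finset_eq_zero (Finset.univ.image x)
    swap
    · intro t ht
      obtain ⟨j, -, rfl⟩ := Finset.mem_image.1 ht
      rw [eval_sub, hr, eval_mul, hQ, eval_prod, Finset.prod_eq_zero (Finset.mem_univ j) (by simp)]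
      simp
    · rw [Finset.card_image_of_injective _ hx, Finset.card_univ, Fintype.card_fin,
        degree_lt_iff_coeff_zero]
      intro m hm
      rw [coeff_sub, coeff_C_mul]
      rcases hm.eq_or_lt with rfl | hlt
      · have : Q.coeff N = 1 := by
          have := hQm.coeff_natDegree; rwa [hQd] at this
        rw [this, ← hc]; ring
      · rw [coeff_eq_zero_of_natDegree_lt ((J_deg N a b).trans_lt hlt),
          coeff_eq_zero_of_natDegree_lt (p := Q) (by omega)]
        ring
  exact sub_eq_zero.1 hz

lemma sign_prod {n : ℕ} (x : Fin (n + 1) → ℝ) (hx : StrictMono x) (j : Fin (n + 1)) :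
    0 < (-1 : ℝ) ^ (n + (j : ℕ)) * ∏ k ∈ Finset.univ.erase j, (x j - x k) := by
  have hsplit : Finset.univ.erase j = (Finset.Iio j) ∪ (Finset.Ioi j) := by
    ext k; simp [lt_or_lt_iff_ne]
  have hd : Disjoint (Finset.Iio j) (Finset.Ioi j) := by
    rw [Finset.disjoint_left]; intro k h1 h2
    simp at h1 h2; exact absurd h1 (not_lt.2 h2.le)
  rw [hsplit, Finset.prod_union hd]
  have h1 : 0 < ∏ k ∈ Finset.Iio j, (x j - x k) :=
    Finset.prod_pos (fun k hk => sub_pos.2 (hx (Finset.mem_Iio.1 hk)))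
  have h2 : 0 < ∏ k ∈ Finset.Ioi j, (x k - x j) :=
    Finset.prod_pos (fun k hk => sub_pos.2 (hx (Finset.mem_Ioi.1 hk)))
  have h3 : ∏ k ∈ Finset.Ioi j, (x j - x k) = (-1) ^ (n - (j : ℕ)) * ∏ k ∈ Finset.Ioi j, (x k - x j) := by
    have : n - (j : ℕ) = (Finset.Ioi j).card := by rw [Fin.card_Ioi]; omega
    rw [this, ← Finset.prod_const, ← Finset.prod_mul_distrib]
    exact Finset.prod_congr rfl (fun k _ => by ring)
  have h4 : (-1 : ℝ) ^ (n + (j : ℕ)) * (-1) ^ (n - (j : ℕ)) = 1 := by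
    rw [← pow_add, show n + (j : ℕ) + (n - j) = 2 * n by have := j.2; omega, pow_mul]; simp
  rw [h3]
  have : (-1 : ℝ) ^ (n + (j : ℕ)) * ((∏ k ∈ Finset.Iio j, (x j - x k)) * ((-1) ^ (n - (j : ℕ)) * ∏ k ∈ Finset.Ioi j, (x k - x j)))
    = (∏ k ∈ Finset.Iio j, (x j - x k)) * ∏ k ∈ Finset.Ioi j, (x k - x j) := by
    linear_combination ((∏ k ∈ Finset.Iio j, (x j - x k)) * ∏ k ∈ Finset.Ioi j, (x k - x j)) * h4
  rw [this]; positivity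

lemma mul_sqrt_eq {D Y Z : ℝ} (hD : 0 ≤ D) (hZ : 0 ≤ Z) (h : D ^ 2 * Y = Z ^ 2) :
    D * √Y = Z := by
  rw [← Real.sqrt_sq hD, ← Real.sqrt_mul (sq_nonneg D), h, Real.sqrt_sq hZ]

end JacLob

open JacLob Polynomial in
set_option maxHeartbeats 1000000 in
theorem barycentric_jacobi_lobatto
    (α β : ℝ) (hα : -1 < α) (hβ : -1 < β)
    (n : ℕ) (x : Fin (n + 1) → ℝ)
    (hx_mono : StrictMono x)
    (hx_mem : ∀ j, x j ∈ Set.Ioo (-1 : ℝ) 1)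
    (hx_root : ∀ j, jacobiP (α + 1) (β + 1) (n + 1) (x j) = 0)
    (w wtil : Fin (n + 1) → ℝ)
    (hw : ∀ j, w j = ∫ t in (-1 : ℝ)..1, (1 - t) ^ (α + 1) * (1 + t) ^ (β + 1)
      * ∏ k ∈ Finset.univ.erase j, ((t - x k) / (x j - x k)))
    (hwtil : ∀ j, wtil j = w j / (1 - (x j) ^ 2))
    (C what1 what2 : ℝ)
    (hC : C = (-1 : ℝ) ^ n * Real.Gamma (2 * (n : ℝ) + α + β + 5)
      / ((2 : ℝ) ^ ((n : ℝ) + 1 + (α + β + 3) / 2)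
        * Real.sqrt ((Nat.factorial (n + 1) : ℝ)
            * Real.Gamma ((n : ℝ) + α + β + 4)
            * Real.Gamma ((n : ℝ) + α + 3)
            * Real.Gamma ((n : ℝ) + β + 3))))
    (hwhat1 : what1 = (2 : ℝ) ^ (α + β + 1) * Real.Gamma (β + 1) * Real.Gamma (β + 2)
      * Real.Gamma ((n : ℝ) + α + 3) * (Nat.factorial (n + 1) : ℝ)
      / (Real.Gamma ((n : ℝ) + β + 3) * Real.Gamma ((n : ℝ) + α + β + 4)))
    (hwhat2 : what2 = (2 : ℝ) ^ (α + β + 1) * Real.Gamma (α + 1) * Real.Gamma (α + 2)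
      * Real.Gamma ((n : ℝ) + β + 3) * (Nat.factorial (n + 1) : ℝ)
      / (Real.Gamma ((n : ℝ) + α + 3) * Real.Gamma ((n : ℝ) + α + β + 4)))
    (lamtil : Fin (n + 1) → ℝ) (lamhat1 lamhat2 : ℝ)
    (hlamtil : ∀ j, lamtil j = ((x j - (-1)) * (x j - 1)
      * ∏ k ∈ Finset.univ.erase j, (x j - x k))⁻¹)
    (hlamhat1 : lamhat1 = (((-1 : ℝ) - 1) * ∏ k, ((-1 : ℝ) - x k))⁻¹)
    (hlamhat2 : lamhat2 = (((1 : ℝ) - (-1)) * ∏ k, ((1 : ℝ) - x k))⁻¹) :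
    (∀ j : Fin (n + 1), lamtil j = C * (-1 : ℝ) ^ ((j : ℕ) + 1) * Real.sqrt (wtil j))
      ∧ lamhat1 = C * Real.sqrt ((β + 1) * what1)
      ∧ lamhat2 = C * (-1 : ℝ) ^ n * Real.sqrt ((α + 1) * what2) := by
  have hQJ : J (n + 1) (α + 1) (β + 1)
      = Polynomial.C ((J (n + 1) (α + 1) (β + 1)).coeff (n + 1)) * ∏ k, (X - Polynomial.C (x k)) := by
    apply J_eq (n + 1) _ _ x hx_mono.injective
    intro j
    have h := hx_root j
    have h1 : 0 < 1 - x j := by linarith [(hx_mem j).2]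
    have h2 : 0 < 1 + x j := by linarith [(hx_mem j).1]
    rw [jacobiP, J_rodrigues _ _ _ _ (hx_mem j)] at h
    have p1 := rpow_pos_of_pos h1 (-(α + 1))
    have p2 := rpow_pos_of_pos h2 (-(β + 1))
    have p3 := rpow_pos_of_pos h1 (α + 1)
    have p4 := rpow_pos_of_pos h2 (β + 1)
    have p5 : (0 : ℝ) < (n + 1).factorial := by positivity
    rw [mul_eq_zero, mul_eq_zero, mul_eq_zero, mul_eq_zero, mul_eq_zero] at h
    have p6 : (-1 : ℝ) ^ (n + 1) / (2 ^ (n + 1) * ((n + 1).factorial : ℝ)) ≠ 0 :=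
      div_ne_zero (by simp) (by positivity)
    simpa only [p1.ne', p2.ne', p3.ne', p4.ne', p6, false_or] using h
  have hcoef := J_coeff (n + 1) (α + 1) (β + 1) (by linarith) (by linarith)
  have hone := J_one (n + 1) (α + 1) (β + 1) (by linarith) (by linarith)
  have hneg := J_neg_one (n + 1) (α + 1) (β + 1) (by linarith) (by linarith)
  have horth := J_orth (n + 1) (α + 1) (β + 1) (by linarith) (by linarith)
  have hn0 : (0 : ℝ) ≤ n := Nat.cast_nonneg n
  have hL1 := L_one (A := (n + 1 : ℕ) + (α + 1)) (B := (n + 1 : ℕ) + (β + 1)) (by push_cast; linarith)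
    (by push_cast; linarith)
  set Q : ℝ[X] := ∏ k, (X - Polynomial.C (x k)) with hQ
  set c := (J (n + 1) (α + 1) (β + 1)).coeff (n + 1) with hc
  rw [hQJ] at hone hneg horth
  have hGs : Gamma (((n + 1 : ℕ) : ℝ) + (α + 1) + ((n + 1 : ℕ) + (β + 1)) + 2)
      = (2 * ((n : ℝ) + 1) + (α + 1) + (β + 1) + 1) * Gamma (2 * (n : ℝ) + α + β + 5) := by
    have h := Gamma_add_one (s := 2 * (n : ℝ) + α + β + 5) (by linarith)
    rw [show 2 * ((n : ℝ) + 1) + (α + 1) + (β + 1) + 1 = 2 * (n : ℝ) + α + β + 5 by ring, ← h]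
    congr 1; push_cast; ring
  rw [hGs] at hL1
  have hNc : ((n + 1 : ℕ) : ℝ) = n + 1 := by push_cast; ring
  have r0 : 2 * ((n + 1 : ℕ) : ℝ) + (α + 1) + (β + 1) + 1 = 2 * (n : ℝ) + α + β + 5 := by rw [hNc]; ring
  have r1 : ((n + 1 : ℕ) : ℝ) + (α + 1) + (β + 1) + 1 = (n : ℝ) + α + β + 4 := by rw [hNc]; ring
  have r2 : ((n + 1 : ℕ) : ℝ) + (α + 1) + 1 = (n : ℝ) + α + 3 := by rw [hNc]; ring
  have r3 : ((n + 1 : ℕ) : ℝ) + (β + 1) + 1 = (n : ℝ) + β + 3 := by rw [hNc]; ring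
  have r4 : ((n + 1 : ℕ) : ℝ) + (α + 1) + ((n + 1 : ℕ) + (β + 1)) + 1 = 2 * (n : ℝ) + α + β + 5 := by rw [hNc]; ring
  have ra : α + 1 + 1 = α + 2 := by ring
  have rb : β + 1 + 1 = β + 2 := by ring
  rw [r0, r1] at hcoef
  rw [r2, ra] at hone
  rw [r3, rb] at hneg
  rw [r4, r2, r3] at hL1
  have ga : Gamma (α + 2) = (α + 1) * Gamma (α + 1) := by
    rw [← ra]; exact Gamma_add_one (by linarith)
  have gb : Gamma (β + 2) = (β + 1) * Gamma (β + 1) := by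
    rw [← rb]; exact Gamma_add_one (by linarith)
  have q0 : 0 < Gamma (2 * (n : ℝ) + α + β + 5) := Gamma_pos_of_pos (by linarith)
  have q1 : 0 < Gamma ((n : ℝ) + α + β + 4) := Gamma_pos_of_pos (by linarith)
  have q2 : 0 < Gamma ((n : ℝ) + α + 3) := Gamma_pos_of_pos (by linarith)
  have q3 : 0 < Gamma ((n : ℝ) + β + 3) := Gamma_pos_of_pos (by linarith)
  have q4 : 0 < Gamma (α + 2) := Gamma_pos_of_pos (by linarith)
  have q5 : 0 < Gamma (β + 2) := Gamma_pos_of_pos (by linarith)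
  have qF : (0 : ℝ) < (n + 1).factorial := by positivity
  set G0 := Gamma (2 * (n : ℝ) + α + β + 5)
  set G1 := Gamma ((n : ℝ) + α + β + 4)
  set G2 := Gamma ((n : ℝ) + α + 3)
  set G3 := Gamma ((n : ℝ) + β + 3)
  set Ga := Gamma (α + 2)
  set Gb := Gamma (β + 2)
  set F : ℝ := ((n + 1).factorial : ℝ)
  set ℓ := L ((n + 1 : ℕ) + (α + 1)) ((n + 1 : ℕ) + (β + 1)) 1
  set P : ℝ := (2 : ℝ) ^ (2 * (n : ℝ) + α + β + 5) with hP
  have qP : 0 < P := rpow_pos_of_pos (by norm_num) _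
  have hP2 : P = (2 : ℝ) ^ (α + β + 1) * ((2 : ℝ) ^ (n + 2)) ^ 2 := by
    rw [hP, ← pow_mul, ← rpow_natCast, ← rpow_add (by norm_num)]
    congr 1; push_cast; ring
  set E : ℝ := (2 : ℝ) ^ (α + β + 1) with hE
  have qE : 0 < E := rpow_pos_of_pos (by norm_num) _
  clear_value G0 G1 G2 G3 Ga Gb F ℓ P E
  set D : ℝ := G0 / ((2 : ℝ) ^ ((n : ℝ) + 1 + (α + β + 3) / 2) * √(F * G1 * G2 * G3)) with hD
  clear_value D
  have qD : 0 < D := by rw [hD]; positivity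
  have hCD : C = (-1) ^ n * D := by rw [hC, hD, mul_div_assoc]
  have hD2 : D ^ 2 = G0 ^ 2 / (P * (F * G1 * G2 * G3)) := by
    rw [hD, div_pow, mul_pow, Real.sq_sqrt (by positivity), hP, ← rpow_natCast ((2 : ℝ) ^ _),
      ← rpow_mul (by norm_num)]
    congr 4; push_cast; ring
  have hs2 : ((-1 : ℝ) ^ n) * (-1) ^ n = 1 := by rw [← mul_pow]; simp
  have hcv : c = (-1) ^ (n + 1) * G0 / G1 := by rw [eq_div_iff q1.ne', hcoef]
  have hc0 : c ≠ 0 := by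
    rw [hcv]; exact div_ne_zero (mul_ne_zero (by simp) q0.ne') q1.ne'
  have hsN : (-1 : ℝ) ^ (n + 1) = - (-1) ^ n := by rw [pow_succ]; ring
  have hsn : ((-1 : ℝ) ^ n) ≠ 0 := by simp
  have hQ1 : ∏ k, ((1 : ℝ) - x k) = 2 ^ (n + 1) * G2 * G1 / (Ga * G0) := by
    have e : Q.eval 1 = ∏ k, ((1 : ℝ) - x k) := by rw [hQ, eval_prod]; simp
    rw [eval_mul, eval_C, e, hcv, show (-2 : ℝ) = (-1) * 2 by norm_num, mul_pow, hsN] at hone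
    rw [eq_div_iff (by positivity)]
    field_simp at hone
    linear_combination (-1) * hone
  have hQ2 : ∏ k, ((-1 : ℝ) - x k) = (-1) ^ (n + 1) * (2 ^ (n + 1) * G3 * G1 / (Gb * G0)) := by
    have e : Q.eval (-1) = ∏ k, ((-1 : ℝ) - x k) := by rw [hQ, eval_prod]; simp
    rw [eval_mul, eval_C, e, hcv, hsN] at hneg
    rw [hsN]
    have e2 : (-(-1) ^ n * G0 * Gb) * ∏ k, ((-1 : ℝ) - x k) = 2 ^ (n + 1) * G3 * G1 := by
      rw [← hneg]; field_simp
    rw [mul_div_assoc', eq_div_iff (by positivity), ← e2]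
    linear_combination (-(∏ k, ((-1 : ℝ) - x k)) * (Gb * G0)) * hs2
  refine ⟨?_, ?_, ?_⟩
  · intro j
    set R : ℝ[X] := ∏ k ∈ Finset.univ.erase j, (X - Polynomial.C (x k)) with hR
    have hQR : Q = (X - Polynomial.C (x j)) * R := by
      rw [hQ, hR]
      exact (Finset.mul_prod_erase _ (fun k => X - Polynomial.C (x k)) (Finset.mem_univ j)).symm
    have hQm : Q.Monic := monic_prod_of_monic _ _ (fun k _ => monic_X_sub_C _)
    have hQd : Q.natDegree = n + 1 := by
      rw [hQ, natDegree_prod_of_monic _ _ (fun k _ => monic_X_sub_C _)]; simp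
    have hRm : R.Monic := monic_prod_of_monic _ _ (fun k _ => monic_X_sub_C _)
    have hRd : R.natDegree = n := by
      rw [hR, natDegree_prod_of_monic _ _ (fun k _ => monic_X_sub_C _)]; simp
    have hRe : ∀ t, R.eval t = ∏ k ∈ Finset.univ.erase j, (t - x k) := by
      intro t; rw [hR, eval_prod]; simp
    have hkey := key_weight (n := n) (a := α + 1) (b := β + 1) (h := c⁻¹ * ((-1) ^ (n + 1) * F * ℓ))
      (by linarith) (by linarith) (x j) Q R hQR hQd.le
      (by rw [← hQd]; exact hQm.coeff_natDegree) hRd.le (by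
        have := hRm.coeff_natDegree; rwa [hRd] at this) (by
        intro f hf
        have := horth f hf
        rw [mul_assoc, L_C_mul] at this
        have h3 := (eq_inv_mul_iff_mul_eq₀ hc0).2 this
        rw [h3]; ring)
    have hsign := sign_prod x hx_mono j
    rw [← hRe] at hsign
    set r := R.eval (x j) with hr
    have hr0 : r ≠ 0 := by rintro h; rw [h] at hsign; simp at hsign
    have hwj : w j = L (α + 1) (β + 1) R / r := by
      rw [hw, L, ← intervalIntegral.integral_div]
      congr 1; ext t
      rw [Finset.prod_div_distrib, ← hRe, ← hRe]; ring
    have hu : 0 < 1 - x j ^ 2 := by nlinarith [(hx_mem j).1, (hx_mem j).2]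
    have hG : (1 - x j ^ 2) * r * L (α + 1) (β + 1) R = F * G1 * P * G2 * G3 / G0 ^ 2 := by
      have e3 : (2 * ((n : ℝ) + 1) + (α + 1) + (β + 1) + 1) * ℓ = P * G2 * G3 / G0 := by
        rw [eq_div_iff q0.ne', ← hL1]; ring
      have e4 : c⁻¹ * (-1) ^ (n + 1) = G1 / G0 := by
        rw [hcv, hsN]; field_simp
      calc _ = (c⁻¹ * (-1) ^ (n + 1)) * F * ((2 * ((n : ℝ) + 1) + (α + 1) + (β + 1) + 1) * ℓ) := by
            rw [hkey]; ring
        _ = _ := by rw [e3, e4]; field_simp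
    have hLv : L (α + 1) (β + 1) R = F * G1 * P * G2 * G3 / G0 ^ 2 / ((1 - x j ^ 2) * r) := by
      rw [← hG]; field_simp
    have hZ := mul_sqrt_eq (D := D) (Y := wtil j)
      (Z := 1 / ((1 - x j ^ 2) * ((-1) ^ (n + (j : ℕ)) * r))) qD.le (by positivity) (by
        have hss : ((-1 : ℝ) ^ (n + (j : ℕ))) ^ 2 = 1 := by rw [← pow_mul, mul_comm, pow_mul]; simp
        rw [hD2, hwtil, hwj, hLv, div_pow, mul_pow, mul_pow ((-1 : ℝ) ^ _), hss]
        field_simp)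
    have hss : ((-1 : ℝ) ^ (n + (j : ℕ))) ≠ 0 := by simp
    rw [hlamtil, ← hRe, ← hr, hCD]
    have : (-1 : ℝ) ^ n * D * (-1) ^ ((j : ℕ) + 1) * √(wtil j)
        = - (-1 : ℝ) ^ (n + (j : ℕ)) * (D * √(wtil j)) := by rw [pow_succ, pow_add]; ring
    rw [this, hZ, show (x j - -1) * (x j - 1) * r = - ((1 - x j ^ 2) * r) by ring]
    field_simp
  · have hZ := mul_sqrt_eq (D := D) (Y := (β + 1) * what1)
      (Z := Gb * G0 / (2 ^ (n + 2) * G3 * G1)) qD.le (by positivity) (by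
        rw [hD2, hwhat1, hP2]
        have : (β + 1) * (E * Gamma (β + 1) * Gb * G2 * F / (G3 * G1))
          = E * Gb ^ 2 * G2 * F / (G3 * G1) := by rw [gb]; ring
        rw [this]
        field_simp)
    have hi : ((-1 : ℝ) ^ n)⁻¹ = (-1) ^ n := by rw [inv_eq_iff_eq_inv, eq_comm]; exact inv_eq_of_mul_eq_one_left hs2
    rw [hCD, mul_assoc, hZ, hlamhat1, hQ2, hsN]
    rw [show (-1 - 1 : ℝ) * (-(-1) ^ n * (2 ^ (n + 1) * G3 * G1 / (Gb * G0))) = (-1) ^ n * (2 ^ (n + 2) * G3 * G1 / (Gb * G0)) by ring,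
      mul_inv, hi, inv_div]
  · have hZ := mul_sqrt_eq (D := D) (Y := (α + 1) * what2)
      (Z := Ga * G0 / (2 ^ (n + 2) * G2 * G1)) qD.le (by positivity) (by
        rw [hD2, hwhat2, hP2]
        have : (α + 1) * (E * Gamma (α + 1) * Ga * G3 * F / (G2 * G1))
          = E * Ga ^ 2 * G3 * F / (G2 * G1) := by rw [ga]; ring
        rw [this]
        field_simp)
    have : C * (-1) ^ n * √((α + 1) * what2) = D * √((α + 1) * what2) := by
      rw [hCD]; linear_combination (D * √((α + 1) * what2)) * hs2
    rw [this, hZ, hlamhat2, hQ1]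
    field_simp
    ring
end

section
/- Let α, β > −1 and let x_0 < ⋯ < x_n be the n+1 roots of the Jacobi polynomial P_{n+1}^{(α,β+1)}, with Gauss–Jacobi quadrature weights w_j := ∫_{−1}^1 (1−x)^α(1+x)^{β+1} ∏_{k≠j}((x − x_k)/(x_j − x_k)) dx, and set w̃_j := w_j/(1 + x_j) (the interior Gauss–Jacobi–Radau weights for the weight (1−x)^α(1+x)^β). Define C := (−1)^n Γ(2n+α+β+4) / ( 2^{n+1+(α+β+2)/2} √( (n+1)! Γ(n+α+β+3) Γ(n+α+2) Γ(n+β+3) ) ) and ŵ_1 := 2^{α+β+1} Γ(β+1)Γ(β+2)Γ(n+α+2)(n+1)! / ( Γ(n+β+3) Γ(n+α+β+3) ). Consider the combined node set {−1} ∪ {x_0,…,x_n}, with barycentric weights λ̃_j at x_j and λ̂_1 at −1. Then λ̃_j = C (−1)^j √((1 − x_j) w̃_j) for j = 0,…,n, and λ̂_1 = −C √(2(β+1) ŵ_1). -/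
open MeasureTheory Finset Real

/-- Jacobi weight. -/
noncomputable def jw (a b t : ℝ) : ℝ := (1 - t) ^ a * (1 + t) ^ b

lemma jw_int_left {a b : ℝ} (hb : -1 < b) :
    IntervalIntegrable (jw a b) volume (-1) 0 := by
  unfold jw
  apply IntervalIntegrable.continuousOn_mul
  · have h := (intervalIntegral.intervalIntegrable_rpow' (a := 0) (b := 1) hb).comp_add_left 1
    simpa using h
  · rw [Set.uIcc_of_le (by norm_num)]
    intro t ht
    apply ContinuousAt.continuousWithinAt
    apply ContinuousAt.rpow (by fun_prop) (by fun_prop)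
    left; have := ht.2; linarith

lemma jw_int {a b : ℝ} (ha : -1 < a) (hb : -1 < b) :
    IntervalIntegrable (jw a b) volume (-1) 1 := by
  refine (jw_int_left hb).trans ?_
  have h := (jw_int_left (a := b) (b := a) ha)
  rw [IntervalIntegrable.iff_comp_neg] at h
  have e : (fun x => jw b a (-x)) = jw a b := by
    funext x; unfold jw; rw [mul_comm]; congr 2; ring
  rw [e] at h
  simpa using h.symm

lemma jw_poly_int {a b : ℝ} (ha : -1 < a) (hb : -1 < b) (p : Polynomial ℝ) :
    IntervalIntegrable (fun t => jw a b t * p.eval t) volume (-1) 1 :=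
  (jw_int ha hb).mul_continuousOn p.continuous.continuousOn

lemma jw_hasDeriv (a b t : ℝ) (ht : t ∈ Set.Ioo (-1 : ℝ) 1) (p : Polynomial ℝ) :
    HasDerivAt (fun t => jw (a + 1) (b + 1) t * p.eval t)
      (jw a b t * ((1 - Polynomial.X ^ 2) * Polynomial.derivative p
        + (Polynomial.C (b - a) - Polynomial.C (a + b + 2) * Polynomial.X) * p).eval t) t := by
  have h1 : 0 < 1 - t := by linarith [ht.2]
  have h2 : 0 < 1 + t := by linarith [ht.1]
  have d1 : HasDerivAt (fun t : ℝ => (1 - t) ^ (a + 1)) ((-1) * (a + 1) * (1 - t) ^ a) t := by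
    have := ((hasDerivAt_id t).const_sub 1).rpow_const (p := a + 1) (Or.inl h1.ne')
    simpa using this
  have d2 : HasDerivAt (fun t : ℝ => (1 + t) ^ (b + 1)) (1 * (b + 1) * (1 + t) ^ b) t := by
    have := ((hasDerivAt_id t).const_add 1).rpow_const (p := b + 1) (Or.inl h2.ne')
    simpa using this
  have d := (d1.mul d2).mul (p.hasDerivAt t)
  refine HasDerivAt.congr_deriv (f := fun t => jw (a + 1) (b + 1) t * p.eval t) d ?_
  have e1 : (1 - t) ^ (a + 1) = (1 - t) ^ a * (1 - t) := by
    rw [rpow_add h1, rpow_one]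
  have e2 : (1 + t) ^ (b + 1) = (1 + t) ^ b * (1 + t) := by
    rw [rpow_add h2, rpow_one]
  simp [jw, e1, e2]
  ring

/-- Integration functional. -/
noncomputable def JI (a b : ℝ) (p : Polynomial ℝ) : ℝ := ∫ t in (-1 : ℝ)..1, jw a b t * p.eval t

/-- Raising operator. -/
noncomputable def JT (a b : ℝ) (p : Polynomial ℝ) : Polynomial ℝ :=
  (1 - Polynomial.X ^ 2) * Polynomial.derivative p
        + (Polynomial.C (b - a) - Polynomial.C (a + b + 2) * Polynomial.X) * p

lemma JI_add {a b : ℝ} (ha : -1 < a) (hb : -1 < b) (p q : Polynomial ℝ) :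
    JI a b (p + q) = JI a b p + JI a b q := by
  unfold JI
  rw [← intervalIntegral.integral_add (jw_poly_int ha hb p) (jw_poly_int ha hb q)]
  simp [mul_add]

lemma JI_C_mul (a b c : ℝ) (p : Polynomial ℝ) :
    JI a b (Polynomial.C c * p) = c * JI a b p := by
  unfold JI
  rw [← intervalIntegral.integral_const_mul]
  congr 1; funext t; simp; ring

lemma JI_JT {a b : ℝ} (ha : -1 < a) (hb : -1 < b) (p : Polynomial ℝ) : JI a b (JT a b p) = 0 := by
  have := intervalIntegral.integral_eq_sub_of_hasDerivAt_of_le (a := (-1 : ℝ)) (b := 1)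
    (f := fun t => jw (a + 1) (b + 1) t * p.eval t) (by norm_num) ?_
    (fun t ht => jw_hasDeriv a b t ht p) (jw_poly_int ha hb (JT a b p))
  · unfold JI JT
    rw [this]
    simp [jw, zero_rpow (show a + 1 ≠ 0 by linarith), zero_rpow (show b + 1 ≠ 0 by linarith)]
  · unfold jw
    apply ContinuousOn.mul _ p.continuous.continuousOn
    apply Continuous.continuousOn
    refine Continuous.mul ?_ ?_
    · exact Continuous.rpow_const (by fun_prop) (fun x => Or.inr (by linarith))
    · exact Continuous.rpow_const (by fun_prop) (fun x => Or.inr (by linarith))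

lemma JI_shift (a b : ℝ) (p : Polynomial ℝ) :
    JI a b ((1 - Polynomial.X ^ 2) * p) = JI (a + 1) (b + 1) p := by
  unfold JI
  rw [intervalIntegral.integral_of_le (by norm_num), intervalIntegral.integral_of_le (by norm_num),
    integral_Ioc_eq_integral_Ioo, integral_Ioc_eq_integral_Ioo]
  refine setIntegral_congr_fun measurableSet_Ioo fun t ht => ?_
  have h1 : 0 < 1 - t := by linarith [ht.2]
  have h2 : 0 < 1 + t := by linarith [ht.1]
  simp [jw, rpow_add h1, rpow_add h2]
  ring

lemma JI_JT_mul {a b : ℝ} (ha : -1 < a) (hb : -1 < b) (p g : Polynomial ℝ) :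
    JI a b (JT a b p * g) = - JI (a + 1) (b + 1) (p * Polynomial.derivative g) := by
  have h := JI_JT ha hb (p * g)
  have e : JT a b (p * g) = JT a b p * g + (1 - Polynomial.X ^ 2) * (p * Polynomial.derivative g) := by
    unfold JT; rw [Polynomial.derivative_mul]; ring
  rw [e, JI_add ha hb, JI_shift] at h
  linarith

/-- Unnormalised Jacobi polynomials. -/
noncomputable def JJ : ℕ → ℝ → ℝ → Polynomial ℝ
  | 0, _, _ => 1
  | N + 1, a, b => JT a b (JJ N (a + 1) (b + 1))

lemma JI_JJ (N : ℕ) : ∀ {a b : ℝ} (_ : -1 < a) (_ : -1 < b) (g : Polynomial ℝ),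
    JI a b (JJ N a b * g) = (-1) ^ N * JI (a + N) (b + N) (Polynomial.derivative^[N] g) := by
  induction N with
  | zero => intro a b ha hb g; simp [JJ]
  | succ N ih =>
    intro a b ha hb g
    rw [JJ, JI_JT_mul ha hb, ih (by linarith) (by linarith), Function.iterate_succ_apply]
    push_cast
    rw [show a + 1 + N = a + (N + 1) by ring, show b + 1 + N = b + (N + 1) by ring]
    ring

lemma JJ_deriv (N : ℕ) : ∀ (a b : ℝ) (t : ℝ), t ∈ Set.Ioo (-1 : ℝ) 1 →
    deriv^[N] (jw (N + a) (N + b)) t = jw a b t * (JJ N a b).eval t := by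
  induction N with
  | zero => intro a b t ht; simp [JJ]
  | succ N ih =>
    intro a b t ht
    rw [Function.iterate_succ_apply']
    have h : deriv^[N] (jw (((N + 1 : ℕ) : ℝ) + a) (((N + 1 : ℕ) : ℝ) + b)) =ᶠ[nhds t]
        fun t => jw (a + 1) (b + 1) t * (JJ N (a + 1) (b + 1)).eval t := by
      filter_upwards [isOpen_Ioo.mem_nhds ht] with s hs
      rw [← ih _ _ s hs]
      push_cast
      rw [show (N : ℝ) + 1 + a = N + (a + 1) by ring, show (N : ℝ) + 1 + b = N + (b + 1) by ring]
    rw [h.deriv_eq, (jw_hasDeriv a b t ht _).deriv]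
    rfl

lemma coeff_JT (a b : ℝ) (p : Polynomial ℝ) (m : ℕ) (h : p.natDegree ≤ m) :
    (JT a b p).natDegree ≤ m + 1 ∧ (JT a b p).coeff (m + 1) = -(m + a + b + 2) * p.coeff m := by
  have hc : ∀ k, m < k → p.coeff k = 0 := fun k hk =>
    Polynomial.coeff_eq_zero_of_natDegree_lt (by omega)
  have e : JT a b p = Polynomial.derivative p - Polynomial.X * (Polynomial.X * Polynomial.derivative p)
      + Polynomial.C (b - a) * p - Polynomial.C (a + b + 2) * (Polynomial.X * p) := by
    unfold JT; ring
  have hx : ∀ k, (Polynomial.X * Polynomial.derivative p).coeff k = k * p.coeff k := by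
    intro k
    cases k with
    | zero => simp
    | succ k => rw [Polynomial.coeff_X_mul, Polynomial.coeff_derivative]; push_cast; ring
  have hk : ∀ k, (JT a b p).coeff (k + 1) = (k + 2) * p.coeff (k + 2) - k * p.coeff k
      + (b - a) * p.coeff (k + 1) - (a + b + 2) * p.coeff k := by
    intro k
    rw [e]
    simp only [Polynomial.coeff_sub, Polynomial.coeff_add, Polynomial.coeff_C_mul,
      Polynomial.coeff_X_mul, hx, Polynomial.coeff_derivative]
    push_cast; ring
  refine ⟨?_, ?_⟩
  · rw [Polynomial.natDegree_le_iff_coeff_eq_zero]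
    intro k hk'
    obtain ⟨k, rfl⟩ : ∃ l, k = l + 1 := ⟨k - 1, by omega⟩
    rw [hk, hc k (by omega), hc (k+1) (by omega), hc (k+2) (by omega)]; ring
  · rw [hk, hc (m+1) (by omega), hc (m+2) (by omega)]; ring

lemma JJ_coeff (N : ℕ) : ∀ (a b : ℝ), 0 < N + a + b + 1 →
    (JJ N a b).natDegree ≤ N ∧
    (JJ N a b).coeff N = (-1) ^ N * Gamma (2 * N + a + b + 1) / Gamma (N + a + b + 1) := by
  induction N with
  | zero =>
    intro a b h
    have := (Gamma_pos_of_pos h).ne'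
    simp [JJ]
    simp at this
    rw [div_self this]
  | succ N ih =>
    intro a b h
    push_cast at h
    obtain ⟨h1, h2⟩ := ih (a + 1) (b + 1) (by linarith)
    obtain ⟨h3, h4⟩ := coeff_JT a b _ _ h1
    refine ⟨h3, ?_⟩
    rw [JJ, h4, h2]
    push_cast
    have g : Gamma (N + (a + 1) + (b + 1) + 1) = (N + a + b + 2) * Gamma (N + 1 + a + b + 1) := by
      rw [show (N : ℝ) + (a + 1) + (b + 1) + 1 = (N + a + b + 2) + 1 by ring,
        Gamma_add_one (by linarith), show (N : ℝ) + 1 + a + b + 1 = N + a + b + 2 by ring]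
    rw [g, show 2 * (N : ℝ) + (a + 1) + (b + 1) + 1 = 2 * (N + 1) + a + b + 1 by ring]
    have := (Gamma_pos_of_pos h).ne'
    have : (N : ℝ) + a + b + 2 ≠ 0 := by linarith
    field_simp
    ring

lemma JJ_eval (N : ℕ) : ∀ (a b : ℝ), -1 < b →
    (JJ N a b).eval (-1) = 2 ^ N * Gamma (N + b + 1) / Gamma (b + 1) := by
  induction N with
  | zero =>
    intro a b h
    have := (Gamma_pos_of_pos (show 0 < b + 1 by linarith)).ne'
    simp [JJ, this]
  | succ N ih =>
    intro a b h
    have := (Gamma_pos_of_pos (show 0 < b + 1 by linarith)).ne'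
    have h1 : b + 1 ≠ 0 := by linarith
    rw [JJ, JT]
    simp [ih (a + 1) (b + 1) (by linarith)]
    rw [Gamma_add_one h1, show (N : ℝ) + (b + 1) + 1 = N + 1 + b + 1 by ring]
    field_simp
    ring

lemma JI_one {a b : ℝ} (ha : -1 < a) (hb : -1 < b) :
    JI a b 1 = 2 ^ (a + b + 1) * (Gamma (a + 1) * Gamma (b + 1) / Gamma (a + b + 2)) := by
  have h := Complex.betaIntegral_scaled ((b + 1 : ℝ) : ℂ) ((a + 1 : ℝ) : ℂ) (a := 2) (by norm_num)
  rw [Complex.betaIntegral_eq_Gamma_mul_div _ _ (by simp; linarith) (by simp; linarith),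
    ← Complex.ofReal_add, Complex.Gamma_ofReal, Complex.Gamma_ofReal, Complex.Gamma_ofReal] at h
  have e : (∫ x in (0:ℝ)..2, (x : ℂ) ^ (((b + 1 : ℝ) : ℂ) - 1)
      * (((2:ℝ) : ℂ) - x) ^ (((a + 1 : ℝ) : ℂ) - 1))
      = ((∫ x in (0:ℝ)..2, x ^ b * (2 - x) ^ a : ℝ) : ℂ) := by
    rw [← intervalIntegral.integral_ofReal]
    refine intervalIntegral.integral_congr fun x hx => ?_
    rw [Set.uIcc_of_le (by norm_num)] at hx
    have h1 : 0 ≤ 2 - x := by linarith [hx.2]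
    rw [Complex.ofReal_mul, Complex.ofReal_cpow hx.1, Complex.ofReal_cpow h1]
    push_cast
    congr 2 <;> ring
  rw [e, show (((b + 1 + (a + 1) : ℝ) : ℂ) - 1) = ((a + b + 1 : ℝ) : ℂ) by push_cast; ring,
    ← Complex.ofReal_cpow (by norm_num)] at h
  have h' : (∫ x in (0:ℝ)..2, x ^ b * (2 - x) ^ a)
      = 2 ^ (a + b + 1) * (Gamma (b + 1) * Gamma (a + 1) / Gamma (b + 1 + (a + 1))) := by
    exact_mod_cast h
  have s := intervalIntegral.integral_comp_add_left (a := (-1:ℝ)) (b := 1)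
    (fun x : ℝ => x ^ b * (2 - x) ^ a) 1
  norm_num at s
  rw [h'] at s
  unfold JI jw
  rw [show a + b + 2 = b + 1 + (a + 1) by ring, mul_comm (Gamma (a + 1)), ← s]
  congr 1; funext t
  simp
  rw [mul_comm]; congr 2; ring

lemma JI_JJ_top {N : ℕ} {a b : ℝ} (ha : -1 < a) (hb : -1 < b) (g : Polynomial ℝ)
    (hg : g.natDegree ≤ N) :
    JI a b (JJ N a b * g) = (-1) ^ N * (N.factorial * g.coeff N) * JI (a + N) (b + N) 1 := by
  rw [JI_JJ N ha hb]
  have : Polynomial.derivative^[N] g = Polynomial.C (N.factorial * g.coeff N) * 1 := by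
    ext m
    rw [Polynomial.coeff_iterate_derivative, mul_one]
    cases m with
    | zero => simp [Nat.descFactorial_self]
    | succ m =>
      rw [Polynomial.coeff_eq_zero_of_natDegree_lt (n := m + 1 + N) (by omega)]
      simp
  rw [this, JI_C_mul]; ring

lemma JJ_eq_prod (n : ℕ) (a b : ℝ) (h0 : 0 < ((n + 1 : ℕ) : ℝ) + a + b + 1) (x : Fin (n + 1) → ℝ)
    (hinj : Function.Injective x) (hx : ∀ j, (JJ (n + 1) a b).eval (x j) = 0) :
    JJ (n + 1) a b = Polynomial.C ((JJ (n + 1) a b).coeff (n + 1))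
      * ∏ k, (Polynomial.X - Polynomial.C (x k)) := by
  have hd := (JJ_coeff (n + 1) a b h0).1
  set c := (JJ (n + 1) a b).coeff (n + 1) with hc
  set q : Polynomial ℝ := ∏ k, (Polynomial.X - Polynomial.C (x k)) with hq
  have hqm : q.Monic := Polynomial.monic_prod_of_monic _ _ fun i _ => Polynomial.monic_X_sub_C _
  have hqd : q.natDegree = n + 1 := by
    rw [hq, Polynomial.natDegree_prod_of_monic _ _ fun i _ => Polynomial.monic_X_sub_C _]
    simp
  have hqc : q.coeff (n + 1) = 1 := by
    rw [← hqd]; exact hqm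
  rw [← sub_eq_zero]
  apply Polynomial.eq_zero_of_natDegree_lt_card_of_eval_eq_zero _ hinj
  · intro j
    rw [Polynomial.eval_sub, hx j, Polynomial.eval_mul, hq, Polynomial.eval_prod,
      Finset.prod_eq_zero (Finset.mem_univ j) (by simp)]
    simp
  · rw [Fintype.card_fin]
    apply Nat.lt_succ_of_le
    rw [Polynomial.natDegree_le_iff_coeff_eq_zero]
    intro k hk
    rw [Polynomial.coeff_sub, Polynomial.coeff_C_mul]
    rcases Nat.eq_or_lt_of_le (Nat.succ_le_of_lt hk) with h | h
    · rw [← h]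
      change c - c * q.coeff (n + 1) = 0
      rw [hqc]; ring
    · rw [Polynomial.coeff_eq_zero_of_natDegree_lt (lt_of_le_of_lt hd h),
        Polynomial.coeff_eq_zero_of_natDegree_lt (n := k) (p := q) (by omega)]
      ring

lemma gauss_weight (n : ℕ) (a b : ℝ) (ha : -1 < a) (hb : -1 < b) (c y : ℝ) (r : Polynomial ℝ)
    (hr : r.Monic) (hrd : r.natDegree = n)
    (hJ : JJ (n + 1) a b = Polynomial.C c * ((Polynomial.X - Polynomial.C y) * r)) :
    c * ((1 - y ^ 2) * (r.eval y * JI a b r))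
      = (-1) ^ (n + 1) * ((n + 1).factorial * (2 * (n + 1) + a + b + 1))
        * JI (a + (n + 1)) (b + (n + 1)) 1 := by
  set q := (Polynomial.X - Polynomial.C y) * r with hq
  have top : ∀ g : Polynomial ℝ, g.natDegree ≤ n + 1 → c * JI a b (q * g) =
      (-1) ^ (n + 1) * ((n + 1).factorial * g.coeff (n + 1)) * JI (a + (n + 1)) (b + (n + 1)) 1 := by
    intro g hg
    have := JI_JJ_top ha hb g hg
    rw [hJ, mul_assoc, JI_C_mul] at this
    exact_mod_cast this
  have hrc : r.coeff n = 1 := by rw [← hrd]; exact hr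
  have hr0 : ∀ k, n < k → r.coeff k = 0 := fun k hk =>
    Polynomial.coeff_eq_zero_of_natDegree_lt (by omega)
  -- step 1 : c * I(r^2) = c * r(y) * I(r)
  have s1 : c * JI a b (r * r) = c * (r.eval y * JI a b r) := by
    obtain ⟨s, hs⟩ := Polynomial.X_sub_C_dvd_sub_C_eval (a := y) (p := r)
    have e : r * r = Polynomial.C (r.eval y) * r + q * s := by
      rw [hq]
      have : r = Polynomial.C (r.eval y) + (Polynomial.X - Polynomial.C y) * s := by
        rw [← hs]; ring
      calc r * r = r * (Polynomial.C (r.eval y) + (Polynomial.X - Polynomial.C y) * s) := by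
            rw [← this]
        _ = _ := by ring
    have hsd : s.natDegree ≤ n := by
      by_cases h0 : s = 0
      · simp [h0]
      have h1 : (r - Polynomial.C (r.eval y)).natDegree ≤ n := by
        rw [Polynomial.natDegree_sub_C, hrd]
      rw [hs, Polynomial.natDegree_mul (Polynomial.X_sub_C_ne_zero y) h0,
        Polynomial.natDegree_X_sub_C] at h1
      omega
    have h2 := top s (by omega)
    rw [Polynomial.coeff_eq_zero_of_natDegree_lt (n := n + 1) (p := s) (by omega)] at h2
    rw [e, JI_add ha hb, JI_C_mul, mul_add, h2]; ring
  -- step 2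
  set G : Polynomial ℝ := Polynomial.C 2 * ((1 - Polynomial.X ^ 2) * Polynomial.derivative r)
    + (Polynomial.C (b - a) - Polynomial.C (a + b + 2) * Polynomial.X
        - Polynomial.X - Polynomial.C y) * r with hG
  have eT : JT a b (q * r) = Polynomial.C (1 - y ^ 2) * (r * r) + q * G := by
    rw [hG, JT, hq]
    simp only [Polynomial.derivative_mul, Polynomial.derivative_sub, Polynomial.derivative_X,
      Polynomial.derivative_C, map_sub, map_one, map_pow, map_ofNat]
    ring
  have eG : G = Polynomial.C 2 * Polynomial.derivative r
      - Polynomial.C 2 * (Polynomial.X * (Polynomial.X * Polynomial.derivative r))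
      + Polynomial.C (b - a - y) * r - Polynomial.C (a + b + 3) * (Polynomial.X * r) := by
    rw [hG]
    simp only [map_sub, map_add, map_ofNat]
    ring
  have hx : ∀ k, (Polynomial.X * Polynomial.derivative r).coeff k = k * r.coeff k := by
    intro k
    cases k with
    | zero => simp
    | succ k => rw [Polynomial.coeff_X_mul, Polynomial.coeff_derivative]; push_cast; ring
  have hk : ∀ k, G.coeff (k + 1) = 2 * ((k + 2) * r.coeff (k + 2)) - 2 * (k * r.coeff k)
      + (b - a - y) * r.coeff (k + 1) - (a + b + 3) * r.coeff k := by
    intro k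
    rw [eG]
    simp only [Polynomial.coeff_sub, Polynomial.coeff_add, Polynomial.coeff_C_mul,
      Polynomial.coeff_X_mul, hx, Polynomial.coeff_derivative]
    push_cast; ring
  have hGd : G.natDegree ≤ n + 1 := by
    rw [Polynomial.natDegree_le_iff_coeff_eq_zero]
    intro k hk'
    obtain ⟨k, rfl⟩ : ∃ l, k = l + 1 := ⟨k - 1, by omega⟩
    rw [hk, hr0 k (by omega), hr0 (k+1) (by omega), hr0 (k+2) (by omega)]; ring
  have h3 := top G hGd
  rw [hk, hr0 (n+1) (by omega), hr0 (n+2) (by omega), hrc] at h3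
  have h4 := JI_JT ha hb (q * r)
  rw [eT, JI_add ha hb, JI_C_mul] at h4
  have h5 : c * ((1 - y ^ 2) * JI a b (r * r)) + c * JI a b (q * G) = 0 := by
    rw [← mul_add, h4, mul_zero]
  rw [h3] at h5
  calc c * ((1 - y ^ 2) * (r.eval y * JI a b r))
      = (1 - y ^ 2) * (c * (r.eval y * JI a b r)) := by ring
    _ = (1 - y ^ 2) * (c * JI a b (r * r)) := by rw [s1]
    _ = _ := by linear_combination h5

lemma prod_sign (n : ℕ) (x : Fin (n + 1) → ℝ) (hx : StrictMono x) (j : Fin (n + 1)) :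
    ∏ k ∈ Finset.univ.erase j, (x j - x k)
      = (-1) ^ (n + (j : ℕ)) * |∏ k ∈ Finset.univ.erase j, (x j - x k)| := by
  have h : ∀ k ∈ Finset.univ.erase j, x j - x k = (if j < k then (-1) else 1) * |x j - x k| := by
    intro k hk
    split_ifs with h
    · rw [abs_of_neg (by linarith [hx h])]; ring
    · have h' : k < j := lt_of_le_of_ne (not_lt.mp h) (Finset.ne_of_mem_erase hk)
      rw [abs_of_pos (by linarith [hx h'])]; ring
  have hs : ∏ k ∈ Finset.univ.erase j, (if j < k then (-1 : ℝ) else 1) = (-1) ^ (n + (j : ℕ)) := by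
    rw [Finset.prod_ite, Finset.prod_const_one, mul_one, Finset.prod_const]
    have : (Finset.univ.erase j).filter (fun k => j < k) = Finset.Ioi j := by
      ext k; simp; intro h; exact h.ne'
    rw [this, Fin.card_Ioi]
    have hj := j.isLt
    rw [show n + (j : ℕ) = (n + 1 - 1 - j) + 2 * j by omega, pow_add, pow_mul]
    simp
  rw [Finset.abs_prod, ← hs, ← Finset.prod_mul_distrib]
  exact Finset.prod_congr rfl h

/-- **Theorem 3.5: barycentric weights for Gauss–Jacobi–Radau points.**
Let `x_j` be the roots of `P_{n+1}^{(α,β+1)}` and consider interpolation in the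
combined node set `{-1} ∪ {x_j}`.  With `w̃_j = w_j/(1+x_j)` the interior Radau
weights and `ŵ_1` the boundary weight, the barycentric weights satisfy
`λ̃_j = C (-1)^j √((1-x_j) w̃_j)` and `λ̂_1 = -C √(2(β+1) ŵ_1)`. -/
theorem barycentric_jacobi_radau
    (α β : ℝ) (hα : -1 < α) (hβ : -1 < β)
    (n : ℕ) (x : Fin (n + 1) → ℝ)
    (hx_mono : StrictMono x)
    (hx_mem : ∀ j, x j ∈ Set.Ioo (-1 : ℝ) 1)
    (hx_root : ∀ j, jacobiP α (β + 1) (n + 1) (x j) = 0)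
    (w wtil : Fin (n + 1) → ℝ)
    (hw : ∀ j, w j = ∫ t in (-1 : ℝ)..1, (1 - t) ^ α * (1 + t) ^ (β + 1)
      * ∏ k ∈ Finset.univ.erase j, ((t - x k) / (x j - x k)))
    (hwtil : ∀ j, wtil j = w j / (1 + x j))
    (C what1 : ℝ)
    (hC : C = (-1 : ℝ) ^ n * Real.Gamma (2 * (n : ℝ) + α + β + 4)
      / ((2 : ℝ) ^ ((n : ℝ) + 1 + (α + β + 2) / 2)
        * Real.sqrt ((Nat.factorial (n + 1) : ℝ)
            * Real.Gamma ((n : ℝ) + α + β + 3)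
            * Real.Gamma ((n : ℝ) + α + 2)
            * Real.Gamma ((n : ℝ) + β + 3))))
    (hwhat1 : what1 = (2 : ℝ) ^ (α + β + 1) * Real.Gamma (β + 1) * Real.Gamma (β + 2)
      * Real.Gamma ((n : ℝ) + α + 2) * (Nat.factorial (n + 1) : ℝ)
      / (Real.Gamma ((n : ℝ) + β + 3) * Real.Gamma ((n : ℝ) + α + β + 3)))
    (lamtil : Fin (n + 1) → ℝ) (lamhat1 : ℝ)
    (hlamtil : ∀ j, lamtil j = ((x j - (-1))
      * ∏ k ∈ Finset.univ.erase j, (x j - x k))⁻¹)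
    (hlamhat1 : lamhat1 = (∏ k, ((-1 : ℝ) - x k))⁻¹) :
    (∀ j : Fin (n + 1),
        lamtil j = C * (-1 : ℝ) ^ (j : ℕ) * Real.sqrt ((1 - x j) * wtil j))
      ∧ lamhat1 = -C * Real.sqrt (2 * (β + 1) * what1) := by
  have hinj := hx_mono.injective
  have hn0 : (0 : ℝ) ≤ n := Nat.cast_nonneg n
  have hb : -1 < β + 1 := by linarith
  set g1 := Real.Gamma (2 * (n : ℝ) + α + β + 4) with hg1
  set g2 := Real.Gamma ((n : ℝ) + α + β + 3) with hg2
  set g3 := Real.Gamma ((n : ℝ) + α + 2) with hg3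
  set g4 := Real.Gamma ((n : ℝ) + β + 3) with hg4
  set F : ℝ := (Nat.factorial (n + 1) : ℝ) with hF
  have p1 : 0 < g1 := Gamma_pos_of_pos (by linarith)
  have p2 : 0 < g2 := Gamma_pos_of_pos (by linarith)
  have p3 : 0 < g3 := Gamma_pos_of_pos (by linarith)
  have p4 : 0 < g4 := Gamma_pos_of_pos (by linarith)
  have pF : 0 < F := by rw [hF]; positivity
  have h0 : 0 < ((n + 1 : ℕ) : ℝ) + α + (β + 1) + 1 := by push_cast; linarith
  have hroot : ∀ j, (JJ (n + 1) α (β + 1)).eval (x j) = 0 := by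
    intro j
    have h := hx_root j
    have h1 : 0 < 1 - x j := by linarith [(hx_mem j).2]
    have h2 : 0 < 1 + x j := by linarith [(hx_mem j).1]
    have h3 := JJ_deriv (n + 1) α (β + 1) (x j) (hx_mem j)
    change deriv^[n + 1] (fun t => (1 - t) ^ (((n + 1 : ℕ) : ℝ) + α)
      * (1 + t) ^ (((n + 1 : ℕ) : ℝ) + (β + 1))) (x j) = _ at h3
    unfold jacobiP at h
    rw [h3] at h
    have q1 : (1 - x j) ^ (-α) ≠ 0 := (rpow_pos_of_pos h1 _).ne'
    have q2 : (1 + x j) ^ (-(β + 1)) ≠ 0 := (rpow_pos_of_pos h2 _).ne'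
    have q3 : jw α (β + 1) (x j) ≠ 0 :=
      (mul_pos (rpow_pos_of_pos h1 _) (rpow_pos_of_pos h2 _)).ne'
    have q4 : ((-1 : ℝ) ^ (n + 1) / ((2 : ℝ) ^ (n + 1) * (Nat.factorial (n + 1) : ℝ))) ≠ 0 := by
      apply div_ne_zero
      · exact pow_ne_zero _ (by norm_num)
      · positivity
    exact (mul_eq_zero.mp ((mul_eq_zero.mp h).resolve_left
      (mul_ne_zero (mul_ne_zero q4 q1) q2))).resolve_left q3
  have hJ := JJ_eq_prod n α (β + 1) h0 x hinj hroot
  have hc : (JJ (n + 1) α (β + 1)).coeff (n + 1) = (-1) ^ (n + 1) * g1 / g2 := by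
    rw [(JJ_coeff (n + 1) α (β + 1) h0).2, hg1, hg2]
    push_cast
    rw [show 2 * ((n : ℝ) + 1) + α + (β + 1) + 1 = 2 * n + α + β + 4 by ring,
      show (n : ℝ) + 1 + α + (β + 1) + 1 = n + α + β + 3 by ring]
  rw [hc] at hJ
  have hB : JI (α + (n + 1)) (β + 1 + (n + 1)) 1 = (2 : ℝ) ^ (2 * (n : ℝ) + α + β + 4)
      * (g3 * g4 / ((2 * n + α + β + 4) * g1)) := by
    rw [JI_one (by linarith) (by linarith), hg1, ← Gamma_add_one (by linarith), hg3, hg4]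
    congr 2
    · ring
    · congr 2 <;> ring
    · congr 1; ring
  set S := Real.sqrt (F * g2 * g3 * g4) with hS
  have pS : 0 < S := Real.sqrt_pos.mpr (by positivity)
  have hS2 : S ^ 2 = F * g2 * g3 * g4 := Real.sq_sqrt (by positivity)
  set P := (2 : ℝ) ^ ((n : ℝ) + 1 + (α + β + 2) / 2) with hP
  have pP : 0 < P := by positivity
  have hP2 : P ^ 2 = (2 : ℝ) ^ (2 * (n : ℝ) + α + β + 4) := by
    rw [hP, ← rpow_natCast, ← rpow_mul (by norm_num)]
    congr 1; push_cast; ring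
  have hsg : ((-1 : ℝ) ^ n) * (-1) ^ n = 1 := by
    rw [← mul_pow]; simp
  constructor
  · intro j
    have h1 : 0 < 1 - x j := by linarith [(hx_mem j).2]
    have h2 : 0 < 1 + x j := by linarith [(hx_mem j).1]
    set r : Polynomial ℝ := ∏ k ∈ Finset.univ.erase j, (Polynomial.X - Polynomial.C (x k)) with hr
    set D := ∏ k ∈ Finset.univ.erase j, (x j - x k) with hD
    have hD0 : D ≠ 0 := by
      rw [hD, Finset.prod_ne_zero_iff]
      intro k hk
      exact sub_ne_zero.mpr fun h => (Finset.ne_of_mem_erase hk) (hinj h).symm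
    have hrm : r.Monic := Polynomial.monic_prod_of_monic _ _ fun i _ => Polynomial.monic_X_sub_C _
    have hrd : r.natDegree = n := by
      rw [hr, Polynomial.natDegree_prod_of_monic _ _ fun i _ => Polynomial.monic_X_sub_C _]
      simp
    have hre : r.eval (x j) = D := by
      rw [hr, hD, Polynomial.eval_prod]; simp
    have hwj : w j = JI α (β + 1) r / D := by
      rw [hw j, JI, ← intervalIntegral.integral_div]
      congr 1; funext t
      rw [Finset.prod_div_distrib, hr, Polynomial.eval_prod, jw]
      simp
      ring
    have hg := gauss_weight n α (β + 1) hα hb _ (x j) r hrm hrd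
      (by rw [hJ, hr, Finset.mul_prod_erase Finset.univ
        (fun k => Polynomial.X - Polynomial.C (x k)) (Finset.mem_univ j)])
    rw [hre, hB, ← hP2, ← hF] at hg
    have hI : JI α (β + 1) r = D * w j := by rw [hwj]; field_simp
    rw [hI] at hg
    have hl : 2 * (n : ℝ) + α + β + 4 ≠ 0 := by linarith
    have hH : (1 - x j) * (1 + x j) * (D ^ 2 * w j) = (P * S / g1) ^ 2 := by
      have e1 : (-1 : ℝ) ^ (n + 1) * (-1) ^ (n + 1) = 1 := by rw [← mul_pow]; simp
      rw [div_pow, mul_pow, hS2]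
      have e2 : (F * (2 * ((n : ℝ) + 1) + α + (β + 1) + 1))
          * (P ^ 2 * (g3 * g4 / ((2 * n + α + β + 4) * g1))) = F * P ^ 2 * g3 * g4 / g1 := by
        field_simp; ring
      rw [mul_assoc _ (F * _), e2] at hg
      have e3 : g1 / g2 * ((1 - x j) * (1 + x j) * (D ^ 2 * w j)) = F * P ^ 2 * g3 * g4 / g1 := by
        linear_combination (-1 : ℝ) ^ (n + 1) * hg - (g1 / g2 * ((1 - x j) * (1 + x j) * (D ^ 2 * w j)) - F * P ^ 2 * g3 * g4 / g1) * e1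
      field_simp at e3 ⊢
      linear_combination e3
    have hq : (1 - x j) * wtil j = (P * S / g1 / ((1 + x j) * |D|)) ^ 2 := by
      rw [div_pow, ← hH, hwtil, mul_pow, sq_abs]
      field_simp
    have hDa : 0 < |D| := abs_pos.mpr hD0
    rw [hq, Real.sqrt_sq (by positivity), hlamtil, hC, ← hD]
    have hsD : D = (-1) ^ (n + (j : ℕ)) * |D| := prod_sign n x hx_mono j
    have hsj : ((-1 : ℝ) ^ (j : ℕ)) * (-1) ^ (j : ℕ) = 1 := by rw [← mul_pow]; simp
    apply inv_eq_of_mul_eq_one_right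
    rw [show x j - -1 = 1 + x j by ring]
    have : (1 + x j) * D * ((-1) ^ n * g1 / (P * S) * (-1) ^ (j : ℕ)
        * (P * S / g1 / ((1 + x j) * |D|))) = D * (-1) ^ n * (-1) ^ (j : ℕ) / |D| := by
      field_simp
    rw [this]
    nth_rewrite 1 [hsD]
    rw [pow_add, div_eq_one_iff_eq hDa.ne']
    linear_combination |D| * hsj * ((-1 : ℝ) ^ n * (-1) ^ n) + |D| * hsg
  · have he := JJ_eval (n + 1) α (β + 1) hb
    rw [hJ, Polynomial.eval_mul, Polynomial.eval_prod] at he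
    simp only [Polynomial.eval_C, Polynomial.eval_sub, Polynomial.eval_X] at he
    set Q := ∏ k, ((-1 : ℝ) - x k) with hQ
    set G := Real.Gamma (β + 2) with hG
    have pG : 0 < G := Gamma_pos_of_pos (by linarith)
    have hGr : G = (β + 1) * Real.Gamma (β + 1) := by
      rw [hG, ← Gamma_add_one (by linarith)]; congr 1; ring
    rw [show (((n + 1 : ℕ) : ℝ) + (β + 1) + 1) = (n : ℝ) + β + 3 by push_cast; ring,
      show β + 1 + 1 = β + 2 by ring, ← hg4, ← hG] at he
    have hP3 : P ^ 2 = (2 ^ (n + 1)) ^ 2 * (2 * (2 : ℝ) ^ (α + β + 1)) := by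
      rw [hP2, show 2 * (n : ℝ) + α + β + 4 = ((((n + 1) * 2 : ℕ) : ℝ) + 1) + (α + β + 1) by
        push_cast; ring, rpow_add (by norm_num), rpow_add (by norm_num), rpow_one, rpow_natCast,
        pow_mul]
      ring
    have hq : 2 * (β + 1) * what1 = (G * (P * S) / (2 ^ (n + 1) * g4 * g2)) ^ 2 := by
      rw [hwhat1, div_pow, mul_pow, mul_pow P, hP3, hS2]
      field_simp
      rw [hGr]
    rw [hq, Real.sqrt_sq (by positivity), hlamhat1, hC]
    have hQ1 : (-1) ^ (n + 1) * Q = 2 ^ (n + 1) * g4 * g2 / (G * g1) := by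
      field_simp at he ⊢
      linear_combination he
    apply inv_eq_of_mul_eq_one_right
    have : Q * (-((-1) ^ n * g1 / (P * S)) * (G * (P * S) / (2 ^ (n + 1) * g4 * g2)))
        = ((-1) ^ (n + 1) * Q) * (G * g1 / (2 ^ (n + 1) * g4 * g2)) := by
      field_simp; ring
    rw [this, hQ1]
    field_simp
end

section
/- Let α, β > −1 and n ≥ 1, and let −1 = x_0 < x_1 < ⋯ < x_n < 1 be the n+1 roots of (1+x)P_n^{(α,β+1)}(x) (the Gauss–Jacobi–Radau points). Let λ_j := 1/∏_{k≠j}(x_j − x_k) be the barycentric weights and w_j := ∫_{−1}^1 (1−x)^α(1+x)^β ∏_{k≠j}((x − x_k)/(x_j − x_k)) dx the weights of the interpolatory quadrature rule for the Jacobi weight at these nodes. Set δ_0 := β+1 and δ_j := 1 for j ≥ 1. Then there is a nonzero constant c, independent of j, such that λ_j = c (−1)^j √((1 − x_j) δ_j w_j) for all j = 0,…,n. -/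
open MeasureTheory Finset Real

namespace JR
open Polynomial

noncomputable def J (a b : ℝ) (S : ℝ[X]) : ℝ :=
  ∫ t in (-1 : ℝ)..1, (1 - t) ^ a * (1 + t) ^ b * S.eval t

lemma integrable0 {a b : ℝ} (ha : -1 < a) (hb : -1 < b) :
    IntervalIntegrable (fun t : ℝ => (1 - t) ^ a * (1 + t) ^ b) volume (-1) 1 := by
  have h1 : IntervalIntegrable (fun t : ℝ => (1 + t) ^ b) volume (-1) 0 := by
    have := (intervalIntegral.intervalIntegrable_rpow' (a := 0) (b := 1) hb).comp_add_left 1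
    simpa using this
  have h2 : IntervalIntegrable (fun t : ℝ => (1 - t) ^ a) volume 0 1 := by
    have := (intervalIntegral.intervalIntegrable_rpow' (a := 1) (b := 0) ha).comp_sub_left 1
    simpa using this
  refine IntervalIntegrable.trans (b := 0) ?_ ?_
  · refine h1.continuousOn_mul ?_
    intro t ht
    rw [Set.uIcc_of_le (by norm_num)] at ht
    refine ContinuousAt.continuousWithinAt ?_
    refine ContinuousAt.rpow_const (by fun_prop) (Or.inl ?_)
    have := ht.2; intro h; linarith
  · refine h2.mul_continuousOn ?_
    intro t ht
    rw [Set.uIcc_of_le (by norm_num)] at ht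
    refine ContinuousAt.continuousWithinAt ?_
    refine ContinuousAt.rpow_const (by fun_prop) (Or.inl ?_)
    have := ht.1; intro h; linarith

lemma integrable {a b : ℝ} (ha : -1 < a) (hb : -1 < b) (S : ℝ[X]) :
    IntervalIntegrable (fun t : ℝ => (1 - t) ^ a * (1 + t) ^ b * S.eval t) volume (-1) 1 :=
  (integrable0 ha hb).mul_continuousOn S.continuous.continuousOn

lemma J_add {a b : ℝ} (ha : -1 < a) (hb : -1 < b) (S T : ℝ[X]) :
    J a b (S + T) = J a b S + J a b T := by
  unfold J
  rw [← intervalIntegral.integral_add (integrable ha hb S) (integrable ha hb T)]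
  simp only [eval_add, mul_add]

lemma J_C_mul {a b : ℝ} (c : ℝ) (S : ℝ[X]) : J a b (C c * S) = c * J a b S := by
  unfold J
  rw [← intervalIntegral.integral_const_mul]
  congr 1; ext t; simp; ring

lemma J_zero {a b : ℝ} : J a b 0 = 0 := by simp [J]

lemma J_sum {a b : ℝ} (ha : -1 < a) (hb : -1 < b) {ι : Type*} (s : Finset ι) (f : ι → ℝ[X]) :
    J a b (∑ i ∈ s, f i) = ∑ i ∈ s, J a b (f i) := by
  classical
  induction s using Finset.induction_on with
  | empty => simp [J_zero]
  | insert i s hi ih => rw [Finset.sum_insert hi, Finset.sum_insert hi, J_add ha hb, ih]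

lemma J_congr {a b a' b' : ℝ} {S T : ℝ[X]}
    (h : ∀ t : ℝ, -1 < t → t < 1 →
      (1 - t) ^ a * (1 + t) ^ b * S.eval t = (1 - t) ^ a' * (1 + t) ^ b' * T.eval t) :
    J a b S = J a' b' T := by
  unfold J
  refine intervalIntegral.integral_congr_ae ?_
  have : ∀ᵐ t : ℝ, t ≠ 1 := by simp [ae_iff, measure_singleton]
  filter_upwards [this] with t ht hm
  rw [Set.uIoc_of_le (by norm_num)] at hm
  exact h t hm.1 (lt_of_le_of_ne hm.2 ht)

lemma J_shift {a b : ℝ} (S : ℝ[X]) : J a b ((1 + X) * S) = J a (b + 1) S := by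
  refine J_congr fun t h1 h2 => ?_
  rw [rpow_add_one (by linarith)]; simp; ring

/-- The Rodrigues step operator. -/
noncomputable def T (a b : ℝ) (R : ℝ[X]) : ℝ[X] :=
  (1 - X) * (1 + X) * derivative R + (C b * (1 - X) - C a * (1 + X)) * R

lemma hasDeriv (a b : ℝ) (R : ℝ[X]) {t : ℝ} (h1 : -1 < t) (h2 : t < 1) :
    HasDerivAt (fun t : ℝ => (1 - t) ^ a * (1 + t) ^ b * R.eval t)
      ((1 - t) ^ (a - 1) * (1 + t) ^ (b - 1) * (T a b R).eval t) t := by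
  have e1 : HasDerivAt (fun t : ℝ => (1 - t) ^ a) (-1 * a * (1 - t) ^ (a - 1)) t :=
    ((hasDerivAt_id t).const_sub 1).rpow_const (Or.inl (by simp; linarith))
  have e2 : HasDerivAt (fun t : ℝ => (1 + t) ^ b) (1 * b * (1 + t) ^ (b - 1)) t :=
    ((hasDerivAt_id t).const_add 1).rpow_const (Or.inl (by simp; linarith))
  have := (e1.mul e2).mul (R.hasDerivAt t)
  refine this.congr_deriv ?_
  have p1 : (1 - t) ^ a = (1 - t) ^ (a - 1) * (1 - t) := by
    rw [← rpow_add_one (by linarith)]; simp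
  have p2 : (1 + t) ^ b = (1 + t) ^ (b - 1) * (1 + t) := by
    rw [← rpow_add_one (by linarith)]; simp
  simp only [Pi.mul_apply, T]
  rw [p1, p2]
  simp
  ring

lemma J_T {a b : ℝ} (ha : 0 < a) (hb : 0 < b) (S : ℝ[X]) : J (a - 1) (b - 1) (T a b S) = 0 := by
  unfold J
  rw [intervalIntegral.integral_eq_sub_of_hasDerivAt_of_le (by norm_num)
    (f := fun t : ℝ => (1 - t) ^ a * (1 + t) ^ b * S.eval t) ?_
    (fun t ht => hasDeriv a b S ht.1 ht.2)
    (integrable (by linarith) (by linarith) _)]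
  · simp [zero_rpow ha.ne', zero_rpow hb.ne']
  · refine ContinuousOn.mul (ContinuousOn.mul ?_ ?_) S.continuous.continuousOn
    · exact ContinuousOn.rpow_const (by fun_prop) (fun _ _ => Or.inr ha.le)
    · exact ContinuousOn.rpow_const (by fun_prop) (fun _ _ => Or.inr hb.le)

noncomputable def R (a b : ℝ) : ℕ → ℝ[X]
  | 0 => 1
  | m + 1 => T (a - m) (b - m) (R a b m)

lemma R_natDegree (a b : ℝ) (m : ℕ) : (R a b m).natDegree ≤ m := by
  induction m with
  | zero => simp [R]
  | succ m ih =>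
    rw [R, T]
    refine natDegree_add_le_of_degree_le ?_ ?_
    · rcases Nat.eq_zero_or_pos m with rfl | hm
      · simp [R]
      · have h1 : ((1 - X) * (1 + X) : ℝ[X]).natDegree ≤ 2 := by compute_degree
        have h2 := natDegree_derivative_le (R a b m)
        refine natDegree_mul_le.trans ?_
        omega
    · have h1 : (C (b - m) * (1 - X) - C (a - m) * (1 + X) : ℝ[X]).natDegree ≤ 1 := by
        compute_degree
      refine natDegree_mul_le.trans ?_
      omega

lemma R_ne (a b : ℝ) (m : ℕ) (h : (m : ℝ) < a + 1) : (R a b m).eval 1 ≠ 0 := by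
  induction m with
  | zero => simp [R]
  | succ m ih =>
    push_cast at h
    have := ih (by linarith)
    simp only [R, T, eval_add, eval_mul, eval_sub, eval_one, eval_X, eval_C, sub_self, zero_mul,
      mul_zero, zero_add, zero_sub]
    refine mul_ne_zero ?_ this
    intro h'
    linarith

lemma iter_deriv (a b : ℝ) (m : ℕ) : ∀ t : ℝ, -1 < t → t < 1 →
    deriv^[m] (fun t : ℝ => (1 - t) ^ a * (1 + t) ^ b) t =
      (1 - t) ^ (a - m) * (1 + t) ^ (b - m) * (R a b m).eval t := by
  induction m with
  | zero => intro t _ _; simp [R]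
  | succ m ih =>
    intro t h1 h2
    rw [Function.iterate_succ_apply']
    have : deriv^[m] (fun t : ℝ => (1 - t) ^ a * (1 + t) ^ b) =ᶠ[nhds t]
        fun t => (1 - t) ^ (a - m) * (1 + t) ^ (b - m) * (R a b m).eval t := by
      filter_upwards [Ioo_mem_nhds h1 h2] with s hs using ih s hs.1 hs.2
    rw [this.deriv_eq, (hasDeriv (a - m) (b - m) (R a b m) h1 h2).deriv]
    push_cast
    rw [R, sub_sub, sub_sub]

lemma R_orth (a b : ℝ) (m : ℕ) (ha : (m : ℝ) < a + 1) (hb : (m : ℝ) < b + 1) :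
    ∀ f : ℝ[X], f.degree < m → J (a - m) (b - m) (R a b m * f) = 0 := by
  induction m with
  | zero =>
    intro f hf
    have : f = 0 := by simpa using hf
    simp [this, J_zero]
  | succ m ih =>
    intro f hf
    push_cast at ha hb
    have h0 := J_T (a := a - m) (b := b - m) (by linarith) (by linarith) (R a b m * f)
    have e : T (a - m) (b - m) (R a b m * f) =
        R a b (m + 1) * f + (1 - X) * (1 + X) * (R a b m * derivative f) := by
      simp only [R, T, derivative_mul]; ring
    rw [e, J_add (by linarith) (by linarith)] at h0
    have h1 : J (a - m - 1) (b - m - 1) ((1 - X) * (1 + X) * (R a b m * derivative f)) =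
        J (a - m) (b - m) (R a b m * derivative f) := by
      refine J_congr fun t h1 h2 => ?_
      have p1 : (1 - t) ^ (a - m) = (1 - t) ^ (a - m - 1) * (1 - t) := by
        rw [← rpow_add_one (by linarith)]; simp
      have p2 : (1 + t) ^ (b - m) = (1 + t) ^ (b - m - 1) * (1 + t) := by
        rw [← rpow_add_one (by linarith)]; simp
      rw [p1, p2]; simp; ring
    rw [h1, ih (by linarith) (by linarith), add_zero] at h0
    · push_cast
      rw [← sub_sub, ← sub_sub]; exact h0
    · by_cases hf0 : f = 0
      · simp [hf0]
      · have h3 := degree_derivative_lt hf0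
        have h4 : f.degree ≤ m := by
          rw [degree_eq_natDegree hf0] at hf ⊢
          norm_cast at hf ⊢
          omega
        exact h3.trans_le h4

/-- Orthogonality of the monic polynomial with the given roots. -/
lemma p_orth {α γ : ℝ} (hα : -1 < α) (hγ : -1 < γ) (n : ℕ) (y : Fin n → ℝ)
    (hy : Function.Injective y) (h1 : ∀ i, -1 < y i) (h2 : ∀ i, y i < 1)
    (hr : ∀ i, jacobiP α γ n (y i) = 0) (f : ℝ[X]) (hf : f.degree < n) :
    J α γ ((∏ i, (X - C (y i))) * f) = 0 := by
  set P := R (n + α) (n + γ) n with hP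
  have hroot : ∀ i, P.eval (y i) = 0 := by
    intro i
    have h := hr i
    have q1 : 0 < 1 - y i := by linarith [h2 i]
    have q2 : 0 < 1 + y i := by linarith [h1 i]
    rw [jacobiP, iter_deriv _ _ _ _ (h1 i) (h2 i)] at h
    have c1 := (rpow_pos_of_pos q1 (-α)).ne'
    have c2 := (rpow_pos_of_pos q2 (-γ)).ne'
    have c3 := (rpow_pos_of_pos q1 (n + α - n)).ne'
    have c4 := (rpow_pos_of_pos q2 (n + γ - n)).ne'
    have c5 : (-1 : ℝ) ^ n / ((2 : ℝ) ^ n * (Nat.factorial n : ℝ)) ≠ 0 := by positivity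
    have h' := (mul_eq_zero.mp h).resolve_left (mul_ne_zero (mul_ne_zero c5 c1) c2)
    exact (mul_eq_zero.mp h').resolve_left (mul_ne_zero c3 c4)
  have hP1 : P.eval 1 ≠ 0 := R_ne _ _ _ (by linarith)
  have hP0 : P ≠ 0 := by rintro h; simp [h] at hP1
  have hdvd : (∏ i, (X - C (y i))) ∣ P := by
    refine Finset.prod_dvd_of_coprime ?_ ?_
    · intro i _ j _ hij
      exact pairwise_coprime_X_sub_C hy hij
    · intro i _
      exact dvd_iff_isRoot.mpr (hroot i)
  obtain ⟨s, hs⟩ := hdvd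
  have hmon : (∏ i, (X - C (y i))).Monic := monic_prod_of_monic _ _ fun i _ => monic_X_sub_C _
  have hs0 : s ≠ 0 := by rintro rfl; simp [hP0] at hs
  have hdeg : (∏ i, (X - C (y i))).natDegree = n := by
    rw [natDegree_prod_of_monic _ _ fun i _ => monic_X_sub_C _]; simp
  have hsd : s.natDegree = 0 := by
    have a1 := R_natDegree (n + α) (n + γ) n
    rw [← hP, hs, hmon.natDegree_mul' hs0, hdeg] at a1
    omega
  rw [eq_C_of_natDegree_eq_zero hsd] at hs hs0
  have hc : s.coeff 0 ≠ 0 := by simpa using hs0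
  have ho := R_orth (n + α) (n + γ) n (by linarith) (by linarith) f hf
  rw [← hP, hs, mul_comm _ (C _), mul_assoc, J_C_mul] at ho
  simpa [hc] using ho

lemma J_pos {a b : ℝ} (ha : -1 < a) (hb : -1 < b) (S : ℝ[X]) (hS : S ≠ 0) :
    0 < J a b (S ^ 2) := by
  unfold J
  have hnn : ∀ t ∈ Set.Ioc (-1 : ℝ) 1, 0 ≤ (1 - t) ^ a * (1 + t) ^ b * (S ^ 2).eval t := by
    intro t ht
    have := rpow_nonneg (by linarith [ht.2] : 0 ≤ 1 - t) a
    have := rpow_nonneg (by linarith [ht.1] : 0 ≤ 1 + t) b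
    rw [eval_pow]; positivity
  rw [intervalIntegral.integral_pos_iff_support_of_nonneg_ae' ?_ (integrable ha hb _)]
  · refine ⟨by norm_num, ?_⟩
    have hsub : Set.Ioo (-1 : ℝ) 1 \ {t | S.IsRoot t} ⊆
        Function.support (fun t : ℝ => (1 - t) ^ a * (1 + t) ^ b * (S ^ 2).eval t) ∩
          Set.Ioc (-1) 1 := by
      rintro t ⟨ht, hr⟩
      refine ⟨?_, ht.1, ht.2.le⟩
      have := (rpow_pos_of_pos (by linarith [ht.2] : 0 < 1 - t) a).ne'
      have := (rpow_pos_of_pos (by linarith [ht.1] : 0 < 1 + t) b).ne'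
      have hr' : S.eval t ≠ 0 := hr
      rw [Function.mem_support, eval_pow]; positivity
    refine lt_of_lt_of_le ?_ (measure_mono hsub)
    rw [measure_sdiff_null ((Polynomial.finite_setOfPred_isRoot hS).measure_zero _)]
    simp
  · rw [Set.uIoc_of_le (by norm_num)]
    exact (ae_restrict_iff' measurableSet_Ioc).mpr (Filter.Eventually.of_forall hnn)

lemma exact_quad {α β : ℝ} (hα : -1 < α) (hβ : -1 < β) (n : ℕ) (x : Fin (n + 1) → ℝ)
    (hx : Function.Injective x) (hx0 : x 0 = -1)
    (ho : ∀ f : ℝ[X], f.degree < n → J α (β + 1) ((∏ i : Fin n, (X - C (x i.succ))) * f) = 0)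
    (f : ℝ[X]) (hf : f.natDegree ≤ 2 * n) :
    J α β f = ∑ j, f.eval (x j) * J α β (Lagrange.basis univ x j) := by
  set q : ℝ[X] := Lagrange.nodal univ x with hq
  have hq' : q = (1 + X) * ∏ i : Fin n, (X - C (x i.succ)) := by
    rw [hq, Lagrange.nodal, Fin.prod_univ_succ, hx0]
    simp [add_comm]
  have hmon : q.Monic := Lagrange.nodal_monic
  have hqd : q.natDegree = n + 1 := by rw [hq, Lagrange.natDegree_nodal]; simp
  have hdec := modByMonic_add_div f q
  have hr : f %ₘ q = Lagrange.interpolate univ x (fun j => f.eval (x j)) := by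
    refine Lagrange.eq_interpolate_of_eval_eq _ hx.injOn ?_ ?_
    · refine (degree_modByMonic_lt f hmon).trans_le ?_
      rw [degree_eq_natDegree hmon.ne_zero, hqd]; simp
    · intro j _
      conv_rhs => rw [← hdec]
      simp [hq, Lagrange.eval_nodal_at_node (mem_univ j)]
  have hs : J α β (q * (f /ₘ q)) = 0 := by
    rcases Nat.eq_zero_or_pos (n : ℕ) with hn | hn
    · have : f /ₘ q = 0 := by
        rw [divByMonic_eq_zero_iff hmon, degree_eq_natDegree hmon.ne_zero, hqd]
        refine degree_le_natDegree.trans_lt ?_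
        norm_cast; omega
      simp [this, J_zero]
    rw [hq', mul_assoc, J_shift, ← hq']
    refine ho _ ?_
    refine degree_le_natDegree.trans_lt ?_
    rw [natDegree_divByMonic f hmon, hqd]
    norm_cast; omega
  conv_lhs => rw [← hdec]
  rw [J_add hα hβ, hs, add_zero, hr, Lagrange.interpolate_apply, J_sum hα hβ]
  simp only [J_C_mul]

lemma annihil {α β : ℝ} (hα : -1 < α) (hβ : -1 < β) (n : ℕ) (x : Fin (n + 1) → ℝ)
    (hx : Function.Injective x) (hx0 : x 0 = -1)
    (ho : ∀ f : ℝ[X], f.degree < n → J α (β + 1) ((∏ i : Fin n, (X - C (x i.succ))) * f) = 0)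
    (g : ℝ[X]) (hg : g.degree < n) :
    ∑ j, (1 - x j) * (if j = 0 then β + 1 else 1) * (∏ k ∈ univ.erase j, (x j - x k)) *
      J α β (Lagrange.basis univ x j) * g.eval (x j) = 0 := by
  set p : ℝ[X] := ∏ i : Fin n, (X - C (x i.succ)) with hp
  have hq' : Lagrange.nodal univ x = (1 + X) * p := by
    rw [Lagrange.nodal, Fin.prod_univ_succ, hx0]
    simp [add_comm, hp]
  have hpd : p.natDegree = n := by
    rw [hp, natDegree_prod_of_monic _ _ fun i _ => monic_X_sub_C _]; simp
  have hpr : ∀ j : Fin (n + 1), j ≠ 0 → p.eval (x j) = 0 := by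
    intro j hj
    obtain ⟨i, rfl⟩ := Fin.exists_succ_eq.mpr hj
    rw [hp, eval_prod]
    exact prod_eq_zero (mem_univ i) (by simp)
  have hD : ∀ j, (∏ k ∈ univ.erase j, (x j - x k)) = (p + (1 + X) * derivative p).eval (x j) := by
    intro j
    have := Lagrange.eval_nodal_derivative_eval_node_eq (v := x) (mem_univ j)
    rw [hq', Lagrange.eval_nodal] at this
    rw [← this]
    simp
  have hgn : g = 0 ∨ g.natDegree < n := by
    by_cases h : g = 0
    · exact Or.inl h
    · right; rw [degree_eq_natDegree h] at hg; exact_mod_cast hg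
  rcases hgn with rfl | hgn
  · simp
  set F : ℝ[X] := (1 - X) * ((1 + X) * derivative p + C (β + 1) * p) * g with hF
  have hFd : F.natDegree ≤ 2 * n := by
    have a1 : ((1 - X) : ℝ[X]).natDegree ≤ 1 := by compute_degree
    have a2 : ((1 + X) : ℝ[X]).natDegree ≤ 1 := by compute_degree
    have a3 := natDegree_derivative_le p
    have a4 : ((1 + X) * derivative p + C (β + 1) * p).natDegree ≤ n := by
      refine natDegree_add_le_of_degree_le ?_ ?_
      · refine natDegree_mul_le.trans ?_
        omega
      · exact (natDegree_C_mul_le _ _).trans hpd.le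
    refine natDegree_mul_le.trans ?_
    have a5 := natDegree_mul_le (p := (1 - X : ℝ[X])) (q := (1 + X) * derivative p + C (β + 1) * p)
    omega
  have hJF : J α β F = 0 := by
    have h0 := J_T (a := α + 1) (b := β + 1) (by linarith) (by linarith) (p * g)
    have e : T (α + 1) (β + 1) (p * g) =
        F + (1 + X) * (p * ((1 - X) * derivative g - C (α + 1) * g)) := by
      simp only [T, hF, derivative_mul]; ring
    rw [add_sub_cancel_right, add_sub_cancel_right, e, J_add hα hβ, J_shift, ho, add_zero] at h0
    · exact h0
    · refine degree_le_natDegree.trans_lt ?_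
      norm_cast
      have a1 : ((1 - X) : ℝ[X]).natDegree ≤ 1 := by compute_degree
      have a3 := natDegree_derivative_le g
      have a4 := natDegree_sub_le ((1 - X) * derivative g) (C (α + 1) * g)
      have a5 := natDegree_C_mul_le (α + 1) g
      have a6 := natDegree_mul_le (p := (1 - X : ℝ[X])) (q := derivative g)
      rcases Nat.eq_zero_or_pos g.natDegree with h | h
      · rw [eq_C_of_natDegree_eq_zero h] at a4 a5 ⊢
        simp only [derivative_C, mul_zero, natDegree_zero, natDegree_C] at a4 a5 ⊢
        refine lt_of_le_of_lt a4 ?_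
        refine max_lt (by omega) (by omega)
      · refine lt_of_le_of_lt a4 (max_lt ?_ ?_) <;> omega
  rw [← hJF, exact_quad hα hβ n x hx hx0 ho F hFd]
  refine sum_congr rfl fun j _ => ?_
  rw [hD j, hF]
  by_cases hj : j = 0
  · subst hj
    simp [hx0]; ring
  · simp [hj, hpr j hj]; ring

lemma basis_eval {n : ℕ} (x : Fin (n + 1) → ℝ) (j : Fin (n + 1)) (t : ℝ) :
    (Lagrange.basis univ x j).eval t = ∏ k ∈ univ.erase j, ((t - x k) / (x j - x k)) := by
  rw [Lagrange.basis, eval_prod]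
  refine prod_congr rfl fun k _ => ?_
  simp [Lagrange.basisDivisor, div_eq_inv_mul]

lemma sign_prod {n : ℕ} (x : Fin (n + 1) → ℝ) (hx : StrictMono x) (j : Fin (n + 1)) :
    0 < (-1 : ℝ) ^ n * (-1) ^ (j : ℕ) * ∏ k ∈ univ.erase j, (x j - x k) := by
  have h1 : ∏ k ∈ univ.erase j, (x j - x k) =
      (∏ k ∈ univ.erase j, (if j < k then (-1 : ℝ) else 1)) * ∏ k ∈ univ.erase j, |x j - x k| := by
    rw [← prod_mul_distrib]
    refine prod_congr rfl fun k hk => ?_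
    split_ifs with h
    · rw [abs_of_neg (by linarith [hx h])]; ring
    · have : k < j := lt_of_le_of_ne (not_lt.mp h) (ne_of_mem_erase hk)
      rw [abs_of_pos (by linarith [hx this])]; ring
  have h2 : (∏ k ∈ univ.erase j, (if j < k then (-1 : ℝ) else 1)) = (-1) ^ (n - j : ℕ) := by
    rw [prod_ite, prod_const, prod_const_one, mul_one]
    congr 1
    have : (univ.erase j).filter (fun k => j < k) = Finset.Ioi j := by
      ext k; simp; intro h; exact h.ne'
    rw [this, Fin.card_Ioi]
    omega
  have hj : (j : ℕ) ≤ n := by omega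
  rw [h1, h2, ← mul_assoc, ← pow_add, ← pow_add]
  have : (n + j + (n - j) : ℕ) = 2 * n := by omega
  rw [this, pow_mul]
  simp only [even_two, Even.neg_pow, one_pow, one_mul]
  refine prod_pos fun k hk => abs_pos.mpr (sub_ne_zero.mpr ?_)
  exact fun h => ne_of_mem_erase hk (hx.injective h).symm

lemma pair {n : ℕ} (x : Fin (n + 1) → ℝ) (hx : Function.Injective x) (v : Fin (n + 1) → ℝ)
    (hv : ∀ g : ℝ[X], g.degree < n → ∑ j, v j * g.eval (x j) = 0) (j : Fin (n + 1)) :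
    v j * (∏ k ∈ univ.erase j, (x j - x k)) = v 0 * ∏ k ∈ univ.erase 0, (x 0 - x k) := by
  by_cases hj : j = 0
  · rw [hj]
  set s : Finset (Fin (n + 1)) := (univ.erase j).erase 0 with hs
  have hs' : s = (univ.erase 0).erase j := by rw [hs, erase_right_comm]
  have h := hv (∏ k ∈ s, (X - C (x k))) ?_
  · rw [Finset.sum_eq_add_of_mem 0 j (mem_univ _) (mem_univ _) (Ne.symm hj)] at h
    · rw [← mul_prod_erase (univ.erase j) (fun k => x j - x k) (a := 0) (by simp [Ne.symm hj]),
        ← mul_prod_erase (univ.erase 0) (fun k => x 0 - x k) (a := j) (by simp [hj]), ← hs, ← hs']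
      simp only [eval_prod, eval_sub, eval_X, eval_C] at h
      linear_combination (x j - x 0) * h
    · intro c _ hc
      rw [eval_prod, prod_eq_zero (i := c) (by simp [hs, hc.1, hc.2]) (by simp), mul_zero]
  · rw [degree_prod_of_monic _ _ fun i _ => monic_X_sub_C _]
    simp only [degree_X_sub_C, sum_const, nsmul_eq_mul, mul_one]
    have : s.card = n - 1 := by
      rw [hs, card_erase_of_mem (by simp [Ne.symm hj]), card_erase_of_mem (mem_univ _)]; simp
    rw [this]
    have : (j : ℕ) ≠ 0 := fun h => hj (Fin.ext h)
    norm_cast; omega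

end JR

/-- **Corollary 3.6: barycentric weights at Gauss–Jacobi–Radau points.**
Let `-1 = x_0 < x_1 < ⋯ < x_n < 1` be the roots of `(1+x) P_n^{(α,β+1)}(x)` and `w_j`
the interpolatory quadrature weights for the Jacobi weight `(1-x)^α (1+x)^β`.  Then
there is a nonzero constant `c`, independent of `j`, such that
`λ_j = c (-1)^j √((1-x_j) δ_j w_j)`, with `δ_0 = β+1` and `δ_j = 1` for `j ≥ 1`. -/
theorem barycentric_jacobi_radau_concise
    (α β : ℝ) (hα : -1 < α) (hβ : -1 < β)
    (n : ℕ) (hn : 1 ≤ n) (x : Fin (n + 1) → ℝ)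
    (hx_mono : StrictMono x)
    (hx0 : x 0 = -1) (hxlt : ∀ j, x j < 1)
    (hx_root : ∀ j, (1 + x j) * jacobiP α (β + 1) n (x j) = 0)
    (lam w : Fin (n + 1) → ℝ)
    (hlam : ∀ j, lam j = (∏ k ∈ Finset.univ.erase j, (x j - x k))⁻¹)
    (hw : ∀ j, w j = ∫ t in (-1 : ℝ)..1, (1 - t) ^ α * (1 + t) ^ β
      * ∏ k ∈ Finset.univ.erase j, ((t - x k) / (x j - x k)))
    (δ : Fin (n + 1) → ℝ)
    (hδ : ∀ j, δ j = if j = 0 then β + 1 else 1) :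
    ∃ c : ℝ, c ≠ 0 ∧
      ∀ j : Fin (n + 1),
        lam j = c * (-1 : ℝ) ^ (j : ℕ) * Real.sqrt ((1 - x j) * δ j * w j) := by
  open Polynomial JR in
  have hinj := hx_mono.injective
  have hpos : ∀ i : Fin n, -1 < x i.succ := fun i => by
    rw [← hx0]; exact hx_mono (Fin.succ_pos i)
  have ho : ∀ f : ℝ[X], f.degree < n →
      J α (β + 1) ((∏ i : Fin n, (X - C (x i.succ))) * f) = 0 := by
    refine p_orth hα (by linarith) n (fun i => x i.succ)
      (fun i j h => Fin.succ_injective _ (hinj h)) hpos (fun i => hxlt _) ?_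
    intro i
    exact (mul_eq_zero.mp (hx_root i.succ)).resolve_left (by linarith [hpos i])
  have hwJ : ∀ j, w j = J α β (Lagrange.basis univ x j) := by
    intro j; rw [hw, J]; simp only [basis_eval]
  set D : Fin (n + 1) → ℝ := fun j => ∏ k ∈ Finset.univ.erase j, (x j - x k) with hD
  have hD0 : ∀ j, D j ≠ 0 := by
    intro j h
    have := sign_prod x hx_mono j
    change 0 < (-1 : ℝ) ^ n * (-1) ^ (j : ℕ) * D j at this
    simp [h] at this
  set K : ℝ := (1 - x 0) * δ 0 * D 0 * w 0 * D 0 with hK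
  have hv : ∀ j, (1 - x j) * δ j * D j * w j * D j = K := by
    refine pair x hinj (fun j => (1 - x j) * δ j * D j * w j) ?_
    intro g hg
    have := annihil hα hβ n x hinj hx0 ho g hg
    simp only [hwJ, hδ]
    exact this
  have hKpos : 0 < K := by
    have h1 : (∏ i : Fin n, (X - C (x i.succ))) ≠ (0 : ℝ[X]) :=
      (monic_prod_of_monic _ _ fun i _ => monic_X_sub_C _).ne_zero
    have h2 := J_pos hα hβ _ h1
    rw [exact_quad hα hβ n x hinj hx0 ho _ (by
      rw [natDegree_pow, natDegree_prod_of_monic _ _ fun i _ => monic_X_sub_C _]; simp),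
      Fin.sum_univ_succ, Finset.sum_eq_zero, add_zero, ← hwJ] at h2
    · have hw0 : 0 < w 0 := pos_of_mul_pos_right h2 (by rw [eval_pow]; positivity)
      rw [hK, hδ, hx0]
      have := hD0 0
      have hb : 0 < β + 1 := by linarith
      have : 0 < D 0 ^ 2 := by positivity
      have : 0 < (1 - -1) * (β + 1) * w 0 * D 0 ^ 2 := by positivity
      simp only [if_true]
      nlinarith
    · intro i _
      rw [eval_pow, eval_prod, Finset.prod_eq_zero (mem_univ i) (by simp)]; simp
  refine ⟨(-1) ^ n / √K, by positivity, fun j => ?_⟩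
  have hs := sign_prod x hx_mono j
  change 0 < (-1 : ℝ) ^ n * (-1) ^ (j : ℕ) * D j at hs
  have hsq : (1 - x j) * δ j * w j = K / ((-1 : ℝ) ^ n * (-1) ^ (j : ℕ) * D j) ^ 2 := by
    have e : ((-1 : ℝ) ^ n * (-1) ^ (j : ℕ) * D j) ^ 2 = D j ^ 2 := by
      rw [mul_pow, mul_pow, ← pow_mul, ← pow_mul, mul_comm n, mul_comm (j : ℕ), pow_mul, pow_mul]
      simp
    rw [e, eq_div_iff (pow_ne_zero _ (hD0 j)), ← hv j]; ring
  rw [hsq, sqrt_div hKpos.le, sqrt_sq hs.le, hlam]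
  change (D j)⁻¹ = _
  have := hD0 j
  have hk : √K ≠ 0 := by positivity
  field_simp
end

section
/- Let α > −1 and let x_0 < ⋯ < x_n be the n+1 roots of the Laguerre polynomial L_{n+1}^{(α+1)}, with Gauss–Laguerre quadrature weights w_j := ∫_0^∞ x^{α+1} e^{−x} ∏_{k≠j}((x − x_k)/(x_j − x_k)) dx, and set w̃_j := w_j/x_j (the interior Gauss–Laguerre–Radau weights for the weight x^α e^{−x}). Define C := (−1)^n / √( Γ(n+α+3) (n+1)! ) and ŵ_1 := Γ(α+1)Γ(α+2)(n+1)! / Γ(n+α+3). Consider the combined node set {0} ∪ {x_0,…,x_n}, with barycentric weights λ̃_j at x_j and λ̂_1 at 0. Then λ̃_j = C (−1)^j √(w̃_j) for j = 0,…,n, and λ̂_1 = −C √((α+1) ŵ_1). -/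
open MeasureTheory Finset Real

/-- The Laguerre polynomial `L_n^{(α)}` defined by the Rodrigues formula. -/
noncomputable def laguerreL (α : ℝ) (n : ℕ) : ℝ → ℝ := fun x =>
  x ^ (-α) * Real.exp x / (Nat.factorial n : ℝ)
    * deriv^[n] (fun t => Real.exp (-t) * t ^ ((n : ℝ) + α)) x

open Polynomial in
/-- The operator with `(t^γ e^{-t} f)' = t^(γ-1) e^{-t} (D f)`. -/
noncomputable def lagD (γ : ℝ) (f : ℝ[X]) : ℝ[X] := (C γ - X) * f + X * derivative f

open Polynomial in
/-- Unnormalised Laguerre polynomial via iterated `lagD`. -/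
noncomputable def lagQ : ℕ → ℝ → ℝ[X]
  | 0, _ => 1
  | N + 1, γ => lagD γ (lagQ N (γ + 1))

open Polynomial in
/-- Moment functional for `t^(γ-1) e^{-t}`. -/
noncomputable def lagI (γ : ℝ) : ℝ[X] →ₗ[ℝ] ℝ :=
  Polynomial.lsum (fun k => Real.Gamma (γ + k) • (LinearMap.id : ℝ →ₗ[ℝ] ℝ))

open Polynomial in
lemma lagI_monomial (γ : ℝ) (k : ℕ) (a : ℝ) :
    lagI γ (monomial k a) = Real.Gamma (γ + k) * a := by
  simp [lagI, Polynomial.lsum_apply, Polynomial.sum_monomial_index]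

open Polynomial in
lemma lagI_X_mul (γ : ℝ) (p : ℝ[X]) : lagI γ (X * p) = lagI (γ + 1) p := by
  induction p using Polynomial.induction_on' with
  | add p q hp hq => rw [mul_add, map_add, map_add, hp, hq]
  | monomial k a =>
    rw [X_mul_monomial, lagI_monomial, lagI_monomial]
    push_cast
    congr 2
    ring

open Polynomial in
lemma lagI_lagD (γ : ℝ) (hγ : 0 < γ) (p : ℝ[X]) : lagI γ (lagD γ p) = 0 := by
  induction p using Polynomial.induction_on' with
  | add p q hp hq =>
    have : lagD γ (p + q) = lagD γ p + lagD γ q := by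
      simp only [lagD, derivative_add]; ring
    rw [this, map_add, hp, hq, add_zero]
  | monomial k a =>
    have hX : X * derivative (monomial k a) = monomial k (a * k) := by
      rw [derivative_monomial, X_mul_monomial]
      cases k with
      | zero => simp
      | succ k => simp
    have hk : (0 : ℝ) < γ + k := by positivity
    have : Real.Gamma (γ + ((k + 1 : ℕ) : ℝ)) = (γ + k) * Real.Gamma (γ + k) := by
      rw [← Real.Gamma_add_one hk.ne']; congr 1; push_cast; ring
    rw [lagD, sub_mul, hX, X_mul_monomial, C_mul_monomial, map_add, map_sub, lagI_monomial,
      lagI_monomial, lagI_monomial, this]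
    ring

open Polynomial in
lemma lagI_lagQ (N : ℕ) : ∀ (γ : ℝ), 0 < γ → ∀ g : ℝ[X],
    lagI γ (lagQ N γ * g) = (-1) ^ N * lagI (γ + N) (derivative^[N] g) := by
  induction N with
  | zero => intro γ _ g; simp [lagQ]
  | succ N ih =>
    intro γ hγ g
    have h0 := lagI_lagD γ hγ (lagQ N (γ + 1) * g)
    have h1 : lagQ (N + 1) γ * g
        = lagD γ (lagQ N (γ + 1) * g) - X * (lagQ N (γ + 1) * derivative g) := by
      simp only [lagQ, lagD, derivative_mul]; ring
    rw [h1, map_sub, h0, lagI_X_mul, ih _ (by linarith), Function.iterate_succ_apply]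
    push_cast
    rw [show γ + 1 + (N : ℝ) = γ + (N + 1) by ring]
    ring

open Polynomial in
lemma lagQ_deg (N : ℕ) : ∀ γ : ℝ, (lagQ N γ).natDegree ≤ N ∧ (lagQ N γ).coeff N = (-1) ^ N := by
  induction N with
  | zero => intro γ; simp [lagQ]
  | succ N ih =>
    intro γ
    obtain ⟨h1, h2⟩ := ih (γ + 1)
    have hz : ∀ m, N < m → (lagQ N (γ + 1)).coeff m = 0 := fun m hm =>
      coeff_eq_zero_of_natDegree_lt (by omega)
    constructor
    · rw [natDegree_le_iff_coeff_eq_zero]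
      intro m hm
      obtain ⟨m, rfl⟩ : ∃ k, m = k + 1 := ⟨m - 1, by omega⟩
      simp [lagQ, lagD, sub_mul, coeff_X_mul, coeff_derivative, hz (m + 1) (by omega),
        hz m (by omega)]
    · simp [lagQ, lagD, sub_mul, coeff_X_mul, coeff_derivative, hz (N + 1) (by omega), h2]
      ring

open Polynomial in
lemma lagQ_zero (N : ℕ) : ∀ γ : ℝ, 0 < γ →
    (lagQ N γ).eval 0 * Real.Gamma γ = Real.Gamma (γ + N) := by
  induction N with
  | zero => intro γ _; simp [lagQ]
  | succ N ih =>
    intro γ hγ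
    have := ih (γ + 1) (by linarith)
    rw [Real.Gamma_add_one hγ.ne'] at this
    push_cast
    rw [show γ + ((N : ℝ) + 1) = γ + 1 + N by ring, ← this]
    simp [lagQ, lagD]
    ring

open Polynomial in
lemma lag_rodrigues (N : ℕ) : ∀ γ : ℝ, ∀ t : ℝ, 0 < t →
    deriv^[N] (fun t => Real.exp (-t) * t ^ ((N : ℝ) + (γ - 1))) t
      = t ^ (γ - 1) * Real.exp (-t) * (lagQ N γ).eval t := by
  induction N with
  | zero => intro γ t _; simp [lagQ]; ring
  | succ N ih =>
    intro γ t ht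
    rw [Function.iterate_succ_apply']
    have he : deriv^[N] (fun t => Real.exp (-t) * t ^ (((N + 1 : ℕ) : ℝ) + (γ - 1)))
        =ᶠ[nhds t] fun t => t ^ γ * Real.exp (-t) * (lagQ N (γ + 1)).eval t := by
      filter_upwards [lt_mem_nhds ht] with s hs
      have := ih (γ + 1) s hs
      rw [show γ + 1 - 1 = γ by ring] at this
      rw [← this]
      have hc : ((N + 1 : ℕ) : ℝ) + (γ - 1) = N + γ := by push_cast; ring
      rw [hc]
    rw [he.deriv_eq]
    have h1 : HasDerivAt (fun t : ℝ => t ^ γ) (γ * t ^ (γ - 1)) t :=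
      Real.hasDerivAt_rpow_const (Or.inl ht.ne')
    have h2 : HasDerivAt (fun t : ℝ => Real.exp (-t)) (Real.exp (-t) * (-1)) t :=
      (hasDerivAt_neg t).exp
    have h3 := (lagQ N (γ + 1)).hasDerivAt t
    have := ((h1.mul h2).mul h3).deriv
    have hp : t ^ γ = t ^ (γ - 1) * t := by
      rw [← Real.rpow_add_one ht.ne']; congr 1; ring
    refine Eq.trans this ?_
    simp only [lagQ, lagD, eval_add, eval_mul, eval_sub, eval_C, eval_X, Pi.mul_apply, hp]
    ring

open Polynomial in
lemma lag_integral (γ : ℝ) (hγ : 0 < γ) (p : ℝ[X]) :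
    IntegrableOn (fun t => t ^ (γ - 1) * Real.exp (-t) * p.eval t) (Set.Ioi 0) ∧
    ∫ t in Set.Ioi (0 : ℝ), t ^ (γ - 1) * Real.exp (-t) * p.eval t = lagI γ p := by
  induction p using Polynomial.induction_on' with
  | add p q hp hq =>
    simp only [eval_add, mul_add]
    exact ⟨hp.1.add hq.1, by rw [integral_add hp.1 hq.1, hp.2, hq.2, map_add]⟩
  | monomial k a =>
    have hk : (0 : ℝ) < γ + k := by positivity
    have he : Set.EqOn (fun t : ℝ => Real.exp (-t) * t ^ (γ + k - 1) * a)
        (fun t => t ^ (γ - 1) * Real.exp (-t) * (monomial k a).eval t) (Set.Ioi 0) := by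
      intro t ht
      have ht : 0 < t := ht
      simp only [eval_monomial]
      rw [show γ + (k : ℝ) - 1 = γ - 1 + k by ring, Real.rpow_add_natCast ht.ne']
      ring
    constructor
    · refine IntegrableOn.congr_fun ?_ he measurableSet_Ioi
      exact (Real.GammaIntegral_convergent hk).mul_const a
    · rw [← setIntegral_congr_fun measurableSet_Ioi he, integral_mul_const, lagI_monomial,
        Real.Gamma_eq_integral hk]

open Polynomial in
lemma lag_weight (N : ℕ) (γ : ℝ) (hγ : 0 < γ) (y : ℝ) (q : ℝ[X])
    (hq : (C ((-1 : ℝ) ^ N) * lagQ (N) γ) = (X - C y) * q) (M : ℕ) (hM : N = M + 1)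
    (hqd : q.natDegree ≤ M) (hqc : q.coeff M = 1) :
    y * q.eval y * lagI γ q = (N.factorial : ℝ) * Real.Gamma (γ + N) := by
  set P : ℝ[X] := C ((-1 : ℝ) ^ N) * lagQ (N) γ with hP
  have hPI : ∀ g : ℝ[X], lagI γ (P * g) = lagI (γ + N) (derivative^[N] g) := by
    intro g
    rw [hP, mul_assoc, ← smul_eq_C_mul, map_smul, lagI_lagQ N γ hγ, smul_eq_mul, ← mul_assoc,
      ← mul_pow]
    simp
  have hPd : P.natDegree ≤ N := (natDegree_C_mul_le _ _).trans (lagQ_deg N γ).1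
  have hev : (derivative P).eval y = q.eval y := by
    rw [hq]; simp
  -- quadrature exactness
  have h1 : lagI γ (q * (X * derivative P)) = y * q.eval y * lagI γ q := by
    obtain ⟨s, hs⟩ : (X - C y) ∣ X * derivative P - C (y * q.eval y) := by
      rw [dvd_iff_isRoot]; simp [hev]
    have hsd : s.natDegree < N := by
      by_cases hs0 : s = 0
      · subst hs0; simp; omega
      have h2 : ((X - C y) * s).natDegree = 1 + s.natDegree := by
        rw [natDegree_mul (X_sub_C_ne_zero y) hs0, natDegree_X_sub_C]
      have h3 : (X * derivative P - C (y * q.eval y)).natDegree ≤ N := by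
        refine (natDegree_sub_le _ _).trans (max_le ?_ (by rw [natDegree_C]; omega))
        refine natDegree_mul_le.trans ?_
        have := natDegree_derivative_le P
        simp only [natDegree_X]
        omega
      rw [hs, h2] at h3
      omega
    have h4 : q * (X * derivative P) = P * s + C (y * q.eval y) * q := by
      have : X * derivative P = (X - C y) * s + C (y * q.eval y) := by rw [← hs]; ring
      rw [this, hq]; ring
    rw [h4, map_add, hPI, iterate_derivative_eq_zero hsd, map_zero, zero_add, ← smul_eq_C_mul,
      map_smul, smul_eq_mul]
  set g : ℝ[X] := X * q - C γ * q - X * derivative q with hg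
  have h2 : q * (X * derivative P) = lagD γ (P * q) + P * g := by
    simp only [hg, lagD, derivative_mul]; ring
  have hz : ∀ m, M < m → q.coeff m = 0 := fun m hm =>
    coeff_eq_zero_of_natDegree_lt (by omega)
  have hgc : ∀ m, N ≤ m → g.coeff m = if m = N then 1 else 0 := by
    intro m hm
    obtain ⟨m, rfl⟩ : ∃ k, m = k + 1 := ⟨m - 1, by omega⟩
    simp only [hg, coeff_sub, coeff_X_mul, coeff_C_mul, coeff_derivative, hz (m + 1) (by omega)]
    split_ifs with h
    · obtain rfl : m = M := by omega
      simp [hqc]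
    · simp [hz m (by omega)]
  have h3 : derivative^[N] g = monomial 0 (N.factorial : ℝ) := by
    ext m
    rw [coeff_iterate_derivative, hgc _ (by omega), coeff_monomial]
    by_cases hm : m = 0
    · subst hm; simp [Nat.descFactorial_self]
    · simp [hm, Ne.symm hm]
  rw [← h1, h2, map_add, lagI_lagD γ hγ, hPI, h3, lagI_monomial]
  simp
  ring

lemma lag_sign (n : ℕ) (x : Fin (n + 1) → ℝ) (hx : StrictMono x) (j : Fin (n + 1)) :
    0 < (-1 : ℝ) ^ n * (-1) ^ (j : ℕ) * ∏ k ∈ Finset.univ.erase j, (x j - x k) := by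
  have h1 : ∏ k ∈ Finset.univ.erase j, (if j < k then (-1 : ℝ) else 1)
      = (-1 : ℝ) ^ n * (-1) ^ (j : ℕ) := by
    rw [Finset.prod_ite, Finset.prod_const, Finset.prod_const_one, mul_one]
    have : (Finset.univ.erase j).filter (fun k => j < k) = Finset.Ioi j := by
      ext k; simp; intro h; exact h.ne'
    rw [this, Fin.card_Ioi]
    have hj : (j : ℕ) ≤ n := by omega
    obtain ⟨m, hm⟩ := Nat.exists_eq_add_of_le hj
    rw [show n + 1 - 1 - (j : ℕ) = m by omega]
    have hp : (-1 : ℝ) ^ n = (-1) ^ ((j : ℕ) + m) := congrArg _ hm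
    rw [hp, pow_add, mul_right_comm, ← mul_pow]
    simp
  rw [← h1, ← Finset.prod_mul_distrib]
  refine Finset.prod_pos fun k hk => ?_
  have hkj : k ≠ j := Finset.ne_of_mem_erase hk
  split_ifs with h
  · have := hx h; linarith
  · have := hx (lt_of_le_of_ne (not_lt.mp h) hkj); linarith

/-- **Theorem 3.8: barycentric weights for Gauss–Laguerre–Radau points.**
Let `x_j` be the roots of `L_{n+1}^{(α+1)}` and consider interpolation in the combined
node set `{0} ∪ {x_j}`.  With `w̃_j = w_j/x_j` the interior Radau weights and `ŵ_1`
the boundary weight, the barycentric weights satisfy `λ̃_j = C (-1)^j √(w̃_j)` and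
`λ̂_1 = -C √((α+1) ŵ_1)`. -/
theorem barycentric_laguerre_radau
    (α : ℝ) (hα : -1 < α)
    (n : ℕ) (x : Fin (n + 1) → ℝ)
    (hx_mono : StrictMono x)
    (hx_mem : ∀ j, 0 < x j)
    (hx_root : ∀ j, laguerreL (α + 1) (n + 1) (x j) = 0)
    (w wtil : Fin (n + 1) → ℝ)
    (hw : ∀ j, w j = ∫ t in Set.Ioi (0 : ℝ), t ^ (α + 1) * Real.exp (-t)
      * ∏ k ∈ Finset.univ.erase j, ((t - x k) / (x j - x k)))
    (hwtil : ∀ j, wtil j = w j / x j)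
    (C what1 : ℝ)
    (hC : C = (-1 : ℝ) ^ n
      / Real.sqrt (Real.Gamma ((n : ℝ) + α + 3) * (Nat.factorial (n + 1) : ℝ)))
    (hwhat1 : what1 = Real.Gamma (α + 1) * Real.Gamma (α + 2)
      * (Nat.factorial (n + 1) : ℝ) / Real.Gamma ((n : ℝ) + α + 3))
    (lamtil : Fin (n + 1) → ℝ) (lamhat1 : ℝ)
    (hlamtil : ∀ j, lamtil j = ((x j - 0)
      * ∏ k ∈ Finset.univ.erase j, (x j - x k))⁻¹)
    (hlamhat1 : lamhat1 = (∏ k, ((0 : ℝ) - x k))⁻¹) :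
    (∀ j : Fin (n + 1), lamtil j = C * (-1 : ℝ) ^ (j : ℕ) * Real.sqrt (wtil j))
      ∧ lamhat1 = -C * Real.sqrt ((α + 1) * what1) := by
  set γ : ℝ := α + 2 with hγdef
  have hγ : 0 < γ := by linarith
  obtain ⟨N, hN⟩ : ∃ N : ℕ, N = n + 1 := ⟨_, rfl⟩
  rw [← hN] at hC hwhat1
  -- the polynomial factorisation
  let P : Polynomial ℝ := Polynomial.C ((-1 : ℝ) ^ N) * lagQ N γ
  have hroot' : ∀ y : ℝ, 0 < y → laguerreL (α + 1) (n + 1) y = 0 → P.eval y = 0 := by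
    intro y hy h
    rw [← hN] at h
    have hr := lag_rodrigues N γ y hy
    rw [show γ - 1 = α + 1 by rw [hγdef]; ring] at hr
    unfold laguerreL at h
    rw [hr] at h
    have a1 := (Real.rpow_pos_of_pos hy (-(α + 1))).ne'
    have a2 := (Real.rpow_pos_of_pos hy (α + 1)).ne'
    have a3 := (Real.exp_pos y).ne'
    have a4 := (Real.exp_pos (-y)).ne'
    have a5 : (Nat.factorial N : ℝ) ≠ 0 := by positivity
    have : (lagQ N γ).eval y = 0 := by
      have h' := (mul_eq_zero.mp h).resolve_left (div_ne_zero (mul_ne_zero a1 a3) a5)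
      exact (mul_eq_zero.mp h').resolve_left (mul_ne_zero a2 a4)
    simp [P, this]
  have hroot : ∀ j, P.eval (x j) = 0 := fun j => hroot' _ (hx_mem j) (hx_root j)
  have hPd : P.natDegree ≤ N :=
    (Polynomial.natDegree_C_mul_le _ _).trans (lagQ_deg N γ).1
  have hPc : P.coeff N = 1 := by
    simp only [P, Polynomial.coeff_C_mul, (lagQ_deg N γ).2, ← mul_pow]
    simp
  have hPm : P.Monic := Polynomial.monic_of_natDegree_le_of_coeff_eq_one N hPd hPc
  have hPprod : P = ∏ k, (Polynomial.X - Polynomial.C (x k)) := by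
    have hm : (∏ k, (Polynomial.X - Polynomial.C (x k))).Monic :=
      Polynomial.monic_prod_of_monic _ _ fun k _ => Polynomial.monic_X_sub_C _
    have hd : (∏ k, (Polynomial.X - Polynomial.C (x k))) ∣ P := by
      refine Finset.prod_dvd_of_coprime ?_ fun k _ => Polynomial.dvd_iff_isRoot.mpr (hroot k)
      intro a _ b _ hab
      exact Polynomial.pairwise_coprime_X_sub_C hx_mono.injective hab
    refine Polynomial.eq_of_monic_of_dvd_of_natDegree_le hm hPm hd ?_
    rw [Polynomial.natDegree_prod_of_monic _ _ fun k _ => Polynomial.monic_X_sub_C _]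
    simpa [hN] using hPd
  have hG : (n : ℝ) + α + 3 = γ + N := by rw [hγdef, hN]; push_cast; ring
  have hGpos : 0 < Real.Gamma (γ + N) := Real.Gamma_pos_of_pos (by positivity)
  have hFpos : (0 : ℝ) < (Nat.factorial N : ℝ) := by positivity
  rw [hG] at hC hwhat1
  set G := Real.Gamma (γ + N) with hGdef
  set F : ℝ := (Nat.factorial N : ℝ) with hFdef
  have hKpos : 0 < Real.sqrt (G * F) := Real.sqrt_pos.mpr (mul_pos hGpos hFpos)
  constructor
  · intro j
    set d := ∏ k ∈ Finset.univ.erase j, (x j - x k) with hd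
    have hs := lag_sign n x hx_mono j
    rw [← hd] at hs
    have hd0 : d ≠ 0 := by rintro h; rw [h] at hs; simp at hs
    let q : Polynomial ℝ := ∏ k ∈ Finset.univ.erase j, (Polynomial.X - Polynomial.C (x k))
    have hqm : q.Monic := Polynomial.monic_prod_of_monic _ _ fun k _ => Polynomial.monic_X_sub_C _
    have hqd : q.natDegree = n := by
      rw [Polynomial.natDegree_prod_of_monic _ _ fun k _ => Polynomial.monic_X_sub_C _]
      simp [hN]
    have hqe : ∀ t, q.eval t = ∏ k ∈ Finset.univ.erase j, (t - x k) := by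
      intro t; simp [q, Polynomial.eval_prod]
    have hPq : P = (Polynomial.X - Polynomial.C (x j)) * q := by
      rw [hPprod]
      exact (Finset.mul_prod_erase _ _ (Finset.mem_univ j)).symm
    have hW := lag_weight N γ hγ (x j) q hPq n hN hqd.le (by rw [← hqd]; exact hqm)
    rw [hqe, ← hd, ← hGdef, ← hFdef] at hW
    have hwj : w j = lagI γ q / d := by
      rw [hw j, ← (lag_integral γ hγ q).2, ← integral_div]
      refine integral_congr_ae (Filter.Eventually.of_forall fun t => ?_)
      simp only [hqe, Finset.prod_div_distrib, ← hd]
      rw [show γ - 1 = α + 1 by rw [hγdef]; ring]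
      ring
    have hxj := hx_mem j
    have hwt : wtil j = G * F / (x j * d) ^ 2 := by
      rw [hwtil, hwj, mul_comm G F, ← hW]
      field_simp
    set σ : ℝ := (-1 : ℝ) ^ n * (-1) ^ (j : ℕ) with hσ
    have hσ2 : σ * σ = 1 := by
      rw [hσ, ← pow_add, ← mul_pow]; simp
    have hsq : Real.sqrt ((x j * d) ^ 2) = x j * (σ * d) := by
      rw [show (x j * d) ^ 2 = (x j * (σ * d)) ^ 2 by
        rw [show (x j * (σ * d)) ^ 2 = (σ * σ) * (x j * d) ^ 2 by ring, hσ2, one_mul]]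
      exact Real.sqrt_sq (by positivity)
    have hσ0 : σ ≠ 0 := by rintro h; rw [h] at hσ2; simp at hσ2
    rw [hlamtil, ← hd, sub_zero, hwt, Real.sqrt_div (by positivity), hsq, hC,
      show (-1 : ℝ) ^ n / √(G * F) * (-1) ^ (j : ℕ) * (√(G * F) / (x j * (σ * d)))
        = σ * (√(G * F) / √(G * F)) / (x j * (σ * d)) by rw [hσ]; ring, div_self hKpos.ne']
    field_simp
  · have h0 := lagQ_zero N γ hγ
    have hΓ : 0 < Real.Gamma γ := Real.Gamma_pos_of_pos hγ
    have hp : (∏ k, ((0 : ℝ) - x k)) = (-1) ^ N * (G / Real.Gamma γ) := by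
      have : P.eval 0 = ∏ k, ((0 : ℝ) - x k) := by rw [hPprod]; simp [Polynomial.eval_prod]
      rw [← this, hGdef, ← h0]
      simp only [P, Polynomial.eval_mul, Polynomial.eval_C]
      field_simp
    have hΓ1 : Real.Gamma γ = (α + 1) * Real.Gamma (α + 1) := by
      rw [← Real.Gamma_add_one (by linarith), hγdef]; congr 1; ring
    have hwv : (α + 1) * what1 = (Real.Gamma γ * F) ^ 2 / (G * F) := by
      rw [hwhat1, show (α + 1) * (Real.Gamma (α + 1) * Real.Gamma γ * F / G)
        = ((α + 1) * Real.Gamma (α + 1)) * Real.Gamma γ * F / G by ring, ← hΓ1]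
      field_simp
    have hss : Real.sqrt (G * F) * Real.sqrt (G * F) = G * F :=
      Real.mul_self_sqrt (by positivity)
    rw [hlamhat1, hp, hwv, Real.sqrt_div (by positivity), Real.sqrt_sq (by positivity), hC,
      show -((-1 : ℝ) ^ n / √(G * F)) * (Real.Gamma γ * F / √(G * F))
        = (-1) ^ (n + 1) * (Real.Gamma γ * F) / (√(G * F) * √(G * F)) by ring, hss, ← hN,
      mul_inv, ← inv_pow, inv_neg_one, inv_div]
    field_simp
end
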